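/- arXiv:1308.2698 — 2 statements merged into one kernel-verified Lean document; each statement's English description precedes it below -/
import Mathlib

section
/- Let M be a positroid on [n]. Then the partition Π*_M of [n] (defined by i ∼* j if and only if y_j − y_i is constant on Γ_M, where y_i = x_1 + ... + x_i) is equal to the Kreweras complement K(Π_M) of the non-crossing partition Π_M of M into the ground sets of its connected components. In particular, Π*_M is a non-crossing partition of [n]. -/
open Finset

/-- A full-row-rank real `d × n` matrix is *totally nonnegative* if all of its
maximal (`d × d`) minors are nonnegative.  Columns are indexed by a finite
linearly ordered set `E`; a maximal minor is indexed by a strictly increasing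
choice of `d` columns. -/
def Matrix.TotallyNonneg {d : ℕ} {E : Type*} [Fintype E] [LinearOrder E]
    (A : Matrix (Fin d) E ℝ) : Prop :=
  A.rank = d ∧ ∀ f : Fin d → E, StrictMono f → 0 ≤ (A.submatrix id f).det

/-- `ℬ` is the collection of bases of the column matroid `M(A)`: the `d`-element
sets of column indices whose columns are linearly independent. -/
def Matrix.RepresentsBases {d : ℕ} {E : Type*} [Fintype E]
    (A : Matrix (Fin d) E ℝ) (ℬ : Finset E → Prop) : Prop :=
  ∀ B : Finset E, ℬ B ↔ B.card = d ∧ LinearIndependent ℝ (fun j : B => fun i => A i j.1)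

/-- A positroid of rank `d` on the finite linearly ordered ground set `E`,
given by its collection of bases `ℬ`. -/
def IsPositroidOfRank (d : ℕ) {E : Type*} [Fintype E] [LinearOrder E]
    (ℬ : Finset E → Prop) : Prop :=
  ∃ A : Matrix (Fin d) E ℝ, A.TotallyNonneg ∧ A.RepresentsBases ℬ

/-- A positroid on the finite linearly ordered ground set `E`. -/
def IsPositroid {E : Type*} [Fintype E] [LinearOrder E] (ℬ : Finset E → Prop) : Prop :=
  ∃ d, IsPositroidOfRank d ℬ


/-- The basis-exchange axiom: `ℬ` is the (nonempty) collection of bases of a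
matroid on the ground set `E`. -/
def IsBasesSet {E : Type*} [DecidableEq E] (ℬ : Finset E → Prop) : Prop :=
  (∃ B, ℬ B) ∧
  ∀ ⦃B₁ B₂ : Finset E⦄, ℬ B₁ → ℬ B₂ → ∀ b₁ ∈ B₁ \ B₂,
    ∃ b₂ ∈ B₂ \ B₁, ℬ (insert b₂ (B₁.erase b₁))

/-- Lexicographic order on two `d`-element subsets of `Fin n` (with respect to
the standard order): comparing the increasing enumerations `s_1 < ... < s_d`
and `t_1 < ... < t_d`, either they agree or they first differ at an index `k`
where `s_k < t_k`. -/
def LexLE {n : ℕ} (d : ℕ) (S T : Finset (Fin n)) : Prop :=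
  ∃ (hS : S.card = d) (hT : T.card = d),
    S = T ∨ ∃ k : Fin d,
      (∀ l, l < k → ((S.orderIsoOfFin hS) l : Fin n) = ((T.orderIsoOfFin hT) l : Fin n)) ∧
      ((S.orderIsoOfFin hS) k : Fin n) < ((T.orderIsoOfFin hT) k : Fin n)

/-- Gale order on two `d`-element subsets of `Fin n` (with respect to the
standard order): the increasing enumerations satisfy `s_k ≤ t_k` for all `k`. -/
def GaleLE {n : ℕ} (d : ℕ) (S T : Finset (Fin n)) : Prop :=
  ∃ (hS : S.card = d) (hT : T.card = d),
    ∀ k : Fin d, ((S.orderIsoOfFin hS) k : Fin n) ≤ ((T.orderIsoOfFin hT) k : Fin n)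

/-- Transfer of a basis collection supported on a subset `S ⊆ Fin n` to a basis
collection on the ground set `S` itself (a subtype carrying the inherited
order). -/
def toSubtypePred {n : ℕ} (S : Finset (Fin n)) (ℬ : Finset (Fin n) → Prop) :
    Finset {x : Fin n // x ∈ S} → Prop :=
  fun C => ℬ (C.map (Function.Embedding.subtype fun x => x ∈ S))

/-- A matroid (given by its basis collection `ℬ` on the ground set `E`) is
*connected* if it cannot be written as the direct sum of two matroids on
nonempty ground sets. -/
def MatroidConnected {E : Type*} [Fintype E] [DecidableEq E] (ℬ : Finset E → Prop) : Prop :=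
  ¬ ∃ (E₁ E₂ : Finset E) (ℬ₁ ℬ₂ : Finset E → Prop),
      E₁.Nonempty ∧ E₂.Nonempty ∧ Disjoint E₁ E₂ ∧ E₁ ∪ E₂ = Finset.univ ∧
      IsBasesSet ℬ₁ ∧ IsBasesSet ℬ₂ ∧
      (∀ B, ℬ₁ B → B ⊆ E₁) ∧ (∀ B, ℬ₂ B → B ⊆ E₂) ∧
      (∀ B, ℬ B ↔ ∃ B₁ B₂, ℬ₁ B₁ ∧ ℬ₂ B₂ ∧ B = B₁ ∪ B₂)

/-- `a, b, c, d` are (distinct and) in cyclic order in `Fin m`. -/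
def Cyc4 {m : ℕ} (a b c d : Fin m) : Prop :=
  0 < (b - a).val ∧ (b - a).val < (c - a).val ∧ (c - a).val < (d - a).val

/-- The matroid (basis) polytope: the convex hull in `ℝ^n` of the indicator
vectors of the bases of the matroid with basis collection `ℬ`. -/
def matroidPolytope {n : ℕ} (ℬ : Finset (Fin n) → Prop) : Set (Fin n → ℝ) :=
  convexHull ℝ {x : Fin n → ℝ | ∃ B, ℬ B ∧ x = fun i => if i ∈ B then (1 : ℝ) else 0}

/-- `P` is a partition of `α` into nonempty blocks (blocks given as sets). -/
def IsPartitionS {α : Type*} (P : Set (Set α)) : Prop :=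
  (∀ S ∈ P, S.Nonempty) ∧ ∀ x : α, ∃! S, S ∈ P ∧ x ∈ S

/-- A collection of subsets of the cyclically ordered set `Fin m` is
non-crossing: no `a, b, c, d` in cyclic order with `a, c` in one member and
`b, d` in a different member. -/
def NonCrossingSetP {m : ℕ} (P : Set (Set (Fin m))) : Prop :=
  ¬ ∃ S ∈ P, ∃ T ∈ P, S ≠ T ∧
      ∃ a b c d : Fin m, a ∈ S ∧ c ∈ S ∧ b ∈ T ∧ d ∈ T ∧ Cyc4 a b c d

/-- The unprimed label `i ∈ [n]` placed at position `2i` in the cyclic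
arrangement `1, 1', 2, 2', ..., n, n'`. -/
def evenEmb (n : ℕ) (i : Fin n) : Fin (2 * n) :=
  ⟨2 * i.val, by have := i.isLt; omega⟩

/-- The primed label `i' ∈ [n]'` placed at position `2i + 1` in the cyclic
arrangement `1, 1', 2, 2', ..., n, n'`. -/
def oddEmb (n : ℕ) (i : Fin n) : Fin (2 * n) :=
  ⟨2 * i.val + 1, by have := i.isLt; omega⟩

/-- The combined collection of blocks on the interleaved cycle
`1, 1', 2, 2', ..., n, n'`: the blocks of `P` on the unprimed labels together
with the blocks of `K` on the primed labels. -/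
def interleave {n : ℕ} (P K : Set (Set (Fin n))) : Set (Set (Fin (2 * n))) :=
  ((fun S => evenEmb n '' S) '' P) ∪ ((fun S => oddEmb n '' S) '' K)

/-- `K` is the Kreweras complement of the non-crossing partition `P` of `[n]`:
`K` is a partition of the primed copy of `[n]` such that the interleaved
collection is non-crossing, and `K` is the coarsest such partition. -/
def IsKrewerasComplement {n : ℕ} (P K : Set (Set (Fin n))) : Prop :=
  IsPartitionS K ∧ NonCrossingSetP (interleave P K) ∧
    ∀ Q : Set (Set (Fin n)), IsPartitionS Q → NonCrossingSetP (interleave P Q) →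
      ∀ T ∈ Q, ∃ S ∈ K, T ⊆ S

/-- The partial sum `y_i = x_1 + ... + x_i` of the coordinates of `x ∈ ℝ^n`. -/
def ySum {n : ℕ} (x : Fin n → ℝ) (i : Fin n) : ℝ :=
  ∑ k ∈ Finset.univ.filter (fun k => k ≤ i), x k

theorem kc_mix {E : Type*} [DecidableEq E] {ℬ : Finset E → Prop} (h : IsBasesSet ℬ)
    (U : Finset E)
    (hU : ∀ B b₁ b₂, ℬ B → b₁ ∈ B → b₂ ∉ B → ℬ (insert b₂ (B.erase b₁)) → (b₁ ∈ U ↔ b₂ ∈ U)) :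
    ∀ (m : ℕ) (B₁ B₂ : Finset E), ((B₁ \ B₂) \ U).card = m → ℬ B₁ → ℬ B₂ →
      ℬ ((B₁ ∩ U) ∪ (B₂ \ U)) := by
  intro m
  induction m with
  | zero =>
    intro B₁ B₂ hc h1 h2
    rw [Finset.card_eq_zero] at hc
    have hsub : ∀ x ∈ B₁, x ∉ U → x ∈ B₂ := by
      intro x hx hxU
      by_contra hx2
      have : x ∈ (B₁ \ B₂) \ U := by simp [hx, hx2, hxU]
      rw [hc] at this
      simp at this
    have hsub2 : ∀ x ∈ B₂, x ∉ U → x ∈ B₁ := by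
      intro x hx hxU
      by_contra hx2
      obtain ⟨y, hy, hB⟩ := h.2 h2 h1 x (by simp [hx, hx2])
      rw [Finset.mem_sdiff] at hy
      have := hU B₂ x y h2 hx hy.2 hB
      have hyU : y ∉ U := fun h' => hxU (this.2 h')
      exact hy.2 (hsub y hy.1 hyU)
    have : (B₁ ∩ U) ∪ (B₂ \ U) = B₁ := by
      ext x
      simp only [Finset.mem_union, Finset.mem_inter, Finset.mem_sdiff]
      have := hsub x
      have := hsub2 x
      tauto
    rwa [this]
  | succ m ih =>
    intro B₁ B₂ hc h1 h2
    have hne : ((B₁ \ B₂) \ U).Nonempty := by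
      rw [← Finset.card_pos]; omega
    obtain ⟨x, hx⟩ := hne
    have hx' := hx
    simp only [Finset.mem_sdiff] at hx'
    obtain ⟨⟨hx1, hx2⟩, hxU⟩ := hx'
    obtain ⟨y, hy, hB⟩ := h.2 h1 h2 x (by simp [hx1, hx2])
    rw [Finset.mem_sdiff] at hy
    have hxy := hU B₁ x y h1 hx1 hy.2 hB
    have hyU : y ∉ U := fun h' => hxU (hxy.2 h')
    have e1 : ((insert y (B₁.erase x)) \ B₂) \ U = ((B₁ \ B₂) \ U).erase x := by
      ext z
      simp only [Finset.mem_sdiff, Finset.mem_insert, Finset.mem_erase]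
      by_cases hz : z = y
      · subst hz; simp [hy.1]
      · tauto
    have e2 : (insert y (B₁.erase x)) ∩ U = B₁ ∩ U := by
      ext z
      simp only [Finset.mem_inter, Finset.mem_insert, Finset.mem_erase]
      by_cases hz : z = y
      · subst hz; simp [hyU]
      · by_cases hz' : z = x
        · subst hz'; simp [hxU]
        · tauto
    have := ih (insert y (B₁.erase x)) B₂ (by rw [e1, Finset.card_erase_of_mem hx, hc]; rfl) hB h2
    rwa [e2] at this

theorem kc_restrict {E : Type*} [DecidableEq E] {ℬ : Finset E → Prop} (h : IsBasesSet ℬ)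
    (U : Finset E)
    (hU : ∀ B b₁ b₂, ℬ B → b₁ ∈ B → b₂ ∉ B → ℬ (insert b₂ (B.erase b₁)) → (b₁ ∈ U ↔ b₂ ∈ U)) :
    IsBasesSet (fun C => ∃ B, ℬ B ∧ C = B ∩ U) := by
  refine ⟨?_, ?_⟩
  · obtain ⟨B, hB⟩ := h.1
    exact ⟨_, B, hB, rfl⟩
  · rintro _ _ ⟨B₁, h1, rfl⟩ ⟨B₂, h2, rfl⟩ x hx
    simp only [Finset.mem_sdiff, Finset.mem_inter, not_and] at hx
    obtain ⟨⟨hx1, hxU⟩, hx2⟩ := hx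
    have hx2 : x ∉ B₂ := fun h' => hx2 h' hxU
    obtain ⟨y, hy, hB⟩ := h.2 h1 h2 x (by simp [hx1, hx2])
    rw [Finset.mem_sdiff] at hy
    have hyU := (hU B₁ x y h1 hx1 hy.2 hB).1 hxU
    refine ⟨y, by simp [hy, hyU], _, hB, ?_⟩
    ext z
    simp only [Finset.mem_inter, Finset.mem_insert, Finset.mem_erase]
    by_cases hz : z = y
    · subst hz; simp [hyU]
    · tauto

theorem kc_conn {E : Type*} [Fintype E] [DecidableEq E] {ℬ : Finset E → Prop} (h : IsBasesSet ℬ)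
    (hc : MatroidConnected ℬ) (U : Finset E)
    (hU : ∀ B b₁ b₂, ℬ B → b₁ ∈ B → b₂ ∉ B → ℬ (insert b₂ (B.erase b₁)) → (b₁ ∈ U ↔ b₂ ∈ U))
    (x y : E) (hx : x ∈ U) (hy : y ∉ U) : False := by
  have hU' : ∀ B b₁ b₂, ℬ B → b₁ ∈ B → b₂ ∉ B → ℬ (insert b₂ (B.erase b₁)) →
      (b₁ ∈ Uᶜ ↔ b₂ ∈ Uᶜ) := by
    intro B b₁ b₂ a b c d
    simp only [Finset.mem_compl]
    rw [hU B b₁ b₂ a b c d]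
  apply hc
  refine ⟨U, Uᶜ, _, _, ⟨x, hx⟩, ⟨y, by simpa using hy⟩, disjoint_compl_right, by simp,
    kc_restrict h U hU, kc_restrict h Uᶜ hU', ?_, ?_, ?_⟩
  · rintro _ ⟨B, _, rfl⟩; exact Finset.inter_subset_right
  · rintro _ ⟨B, _, rfl⟩; exact Finset.inter_subset_right
  · intro B
    constructor
    · intro hB
      refine ⟨_, _, ⟨B, hB, rfl⟩, ⟨B, hB, rfl⟩, ?_⟩
      ext z; simp only [Finset.mem_union, Finset.mem_inter, Finset.mem_compl]; tauto
    · rintro ⟨_, _, ⟨B₁, h1, rfl⟩, ⟨B₂, h2, rfl⟩, rfl⟩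
      have := kc_mix h U hU _ B₁ B₂ rfl h1 h2
      rwa [Finset.sdiff_eq_inter_compl] at this

/-- In a connected component meeting both `U` and its complement there is an exchange
crossing `U`. -/
theorem kc_exchange {n : ℕ} {S : Finset (Fin n)} {ℬ : Finset (Fin n) → Prop} (h : IsBasesSet ℬ)
    (hs : ∀ B, ℬ B → B ⊆ S) (hc : MatroidConnected (toSubtypePred S ℬ))
    (U : Finset (Fin n)) (x y : Fin n) (hxS : x ∈ S) (hyS : y ∈ S) (hx : x ∈ U) (hy : y ∉ U) :
    ∃ B p q, ℬ B ∧ p ∈ B ∧ q ∉ B ∧ ℬ (insert q (B.erase p)) ∧ ¬ (p ∈ U ↔ q ∈ U) := by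
  by_contra hcon
  push Not at hcon
  have key : IsBasesSet (toSubtypePred S ℬ) := by
    refine ⟨?_, ?_⟩
    · obtain ⟨B, hB⟩ := h.1
      refine ⟨B.subtype (fun x => x ∈ S), ?_⟩
      unfold toSubtypePred
      rwa [Finset.subtype_map_of_mem (hs B hB)]
    · intro B₁ B₂ h1 h2 b hb
      obtain ⟨q, hq, hB⟩ := h.2 h1 h2 b (by
        simp only [Finset.mem_sdiff, Finset.mem_map, Function.Embedding.subtype_apply] at hb ⊢
        refine ⟨⟨b, hb.1, rfl⟩, ?_⟩
        rintro ⟨a, ha, hab⟩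
        exact hb.2 (by rwa [Subtype.ext hab] at ha))
      have hqS := hs _ hB (Finset.mem_insert_self _ _)
      refine ⟨⟨q, hqS⟩, ?_, ?_⟩
      · simpa [hqS] using hq
      · unfold toSubtypePred
        rw [Finset.map_insert, Finset.map_erase]
        exact hB
  refine kc_conn key hc (U.subtype (fun x => x ∈ S)) ?_ ⟨x, hxS⟩ ⟨y, hyS⟩ (by simpa using hx)
    (by simpa using hy)
  intro B b₁ b₂ hB hb1 hb2 hB'
  unfold toSubtypePred at hB hB'
  rw [Finset.map_insert, Finset.map_erase] at hB'
  have := hcon _ b₁.1 b₂.1 hB (by simpa using hb1) (by simpa using hb2) hB'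
  simpa using this

theorem kc_pluecker {m : ℕ} {E : Type*} (A : Matrix (Fin (m+2)) E ℝ) (r : Fin m → E)
    (a b c d : E) (D : E → E → ℝ)
    (hD : ∀ x y, D x y = (A.submatrix id (Fin.cons x (Fin.cons y r : Fin (m+1) → E) : Fin (m+2) → E)).det) :
    D a b * D c d = D c b * D a d + D a c * D b d := by
  set M := A.submatrix id (Fin.cons a (Fin.cons b r : Fin (m+1) → E) : Fin (m+2) → E) with hM
  set N := A.submatrix id (Fin.cons a (Fin.cons d r : Fin (m+1) → E) : Fin (m+2) → E) with hN
  have hN0 : ∀ x, N.updateCol 0 (fun i => A i x) =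
      A.submatrix id (Fin.cons x (Fin.cons d r : Fin (m+1) → E) : Fin (m+2) → E) := by
    intro x
    ext i j
    refine Fin.cases ?_ (fun j => ?_) j
    · simp [N]
    · rw [Matrix.updateCol_ne (Fin.succ_ne_zero j)]; simp [N]
  have hM0 : ∀ x, M.updateCol 0 (fun i => A i x) =
      A.submatrix id (Fin.cons x (Fin.cons b r : Fin (m+1) → E) : Fin (m+2) → E) := by
    intro x
    ext i j
    refine Fin.cases ?_ (fun j => ?_) j
    · simp [M]
    · rw [Matrix.updateCol_ne (Fin.succ_ne_zero j)]; simp [M]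
  have hM1 : ∀ x, M.updateCol 1 (fun i => A i x) =
      A.submatrix id (Fin.cons a (Fin.cons x r : Fin (m+1) → E) : Fin (m+2) → E) := by
    intro x
    ext i j
    refine Fin.cases ?_ (fun j => ?_) j
    · rw [Matrix.updateCol_ne (by simp)]; simp [M]
    · refine Fin.cases ?_ (fun j => ?_) j
      · simp [M]
      · rw [Matrix.updateCol_ne (by simp [Fin.ext_iff])]; simp [M]
  have h1 := Matrix.mulVec_cramer M (fun i => A i c)
  have h2 : M.mulVec (M.cramer (fun i => A i c)) =
      ∑ j, (M.cramer (fun i => A i c)) j • (fun i => M i j) := by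
    ext i
    simp [Matrix.mulVec, dotProduct, Finset.sum_apply, mul_comm]
  rw [h2] at h1
  have h3 := congrArg (fun v => N.cramer v 0) h1
  simp only [map_sum, map_smul, Finset.sum_apply, Pi.smul_apply, smul_eq_mul] at h3
  rw [Fin.sum_univ_succ, Fin.sum_univ_succ] at h3
  have hz : ∀ j : Fin m, N.cramer (fun i => M i j.succ.succ) 0 = 0 := by
    intro j
    rw [Matrix.cramer_apply]
    have : (fun i => M i j.succ.succ) = (fun i => A i (r j)) := by ext i; simp [M]
    rw [this, hN0]
    refine Matrix.det_zero_of_column_eq (i := 0) (j := j.succ.succ) (Fin.succ_ne_zero _).symm ?_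
    intro k; simp
  simp only [hz, mul_zero, Finset.sum_const_zero, add_zero] at h3
  have e0 : (fun i => M i 0) = (fun i => A i a) := by ext i; simp [M]
  have e1 : (fun i => M i 1) = (fun i => A i b) := by
    ext i; rw [← Fin.succ_zero_eq_one]; simp [M]
  simp only [Matrix.cramer_apply, e0, e1, hN0, Fin.succ_zero_eq_one, hM0, hM1, ← hD] at h3
  rw [hM, ← hD] at h3
  linarith

theorem kc_sign {d n : ℕ} (A : Matrix (Fin d) (Fin n) ℝ)
    (hA : ∀ f : Fin d → Fin n, StrictMono f → 0 ≤ (A.submatrix id f).det)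
    (f : Fin d → Fin n) (hf : Function.Injective f) :
    0 ≤ (A.submatrix id f).det * (Matrix.vandermonde (fun i => ((f i : ℕ) : ℝ))).det := by
  set σ := Tuple.sort f with hσ
  have hm : StrictMono (f ∘ σ) :=
    (Tuple.monotone_sort f).strictMono_of_injective (hf.comp σ.injective)
  have h1 := hA _ hm
  have h2 : 0 ≤ (Matrix.vandermonde (fun i => (((f ∘ σ) i : ℕ) : ℝ))).det := by
    rw [Matrix.det_vandermonde]
    refine Finset.prod_nonneg fun i _ => Finset.prod_nonneg fun j hj => ?_
    rw [Finset.mem_Ioi] at hj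
    have : (f ∘ σ) i < (f ∘ σ) j := hm hj
    have : (((f ∘ σ) i : ℕ) : ℝ) < (((f ∘ σ) j : ℕ) : ℝ) := by exact_mod_cast this
    linarith
  have e1 : (A.submatrix id (f ∘ σ)).det = (Equiv.Perm.sign σ : ℤ) * (A.submatrix id f).det := by
    have := Matrix.det_permute' σ (A.submatrix id f)
    simpa using this
  have e2 : (Matrix.vandermonde (fun i => (((f ∘ σ) i : ℕ) : ℝ))).det =
      (Equiv.Perm.sign σ : ℤ) * (Matrix.vandermonde (fun i => ((f i : ℕ) : ℝ))).det := by
    have := Matrix.det_permute σ (Matrix.vandermonde (fun i => ((f i : ℕ) : ℝ)))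
    rw [← this]; congr 1
  rw [e1] at h1
  rw [e2] at h2
  rcases Int.units_eq_one_or (Equiv.Perm.sign σ) with h | h <;> rw [h] at h1 h2 <;>
    simp at h1 h2 <;> nlinarith

theorem kc_base {d n : ℕ} (A : Matrix (Fin d) (Fin n) ℝ) {ℬ : Finset (Fin n) → Prop}
    (hr : A.RepresentsBases ℬ) (f : Fin d → Fin n) (hf : Function.Injective f) :
    ℬ (Finset.univ.image f) ↔ (A.submatrix id f).det ≠ 0 := by
  rw [hr, Finset.card_image_of_injective _ hf]
  simp only [Finset.card_univ, Fintype.card_fin, true_and]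
  let e : Fin d ≃ (Finset.univ.image f) :=
    (Equiv.ofInjective f hf).trans (Equiv.subtypeEquivRight (by simp))
  rw [← linearIndependent_equiv e, ← isUnit_iff_ne_zero, ← Matrix.isUnit_iff_isUnit_det,
    ← Matrix.linearIndependent_cols_iff_isUnit]
  rfl

theorem kc_contra {d n : ℕ} (A : Matrix (Fin d) (Fin n) ℝ) {ℬ : Finset (Fin n) → Prop}
    (hA : A.TotallyNonneg) (hr : A.RepresentsBases ℬ) (R : Finset (Fin n)) (a b c e : Fin n)
    (hab : a < b) (hbc : b < c) (hce : c < e)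
    (haR : a ∉ R) (hbR : b ∉ R) (hcR : c ∉ R) (heR : e ∉ R)
    (h1 : ℬ (insert a (insert b R))) (h2 : ℬ (insert c (insert e R)))
    (h3 : ℬ (insert a (insert e R))) (h4 : ℬ (insert b (insert c R)))
    (h5 : ¬ ℬ (insert a (insert c R))) : False := by
  have hd := ((hr _).1 h1).1
  rw [Finset.card_insert_of_notMem (by simp [haR, hab.ne]), Finset.card_insert_of_notMem hbR] at hd
  generalize hm : R.card = m at hd
  subst hd
  set r : Fin m → Fin n := fun i => R.orderEmbOfFin hm i with hrdef
  have hrR : ∀ i, r i ∈ R := fun i => Finset.orderEmbOfFin_mem _ _ _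
  have hrinj : Function.Injective r := (R.orderEmbOfFin hm).injective
  have hrim : Finset.univ.image r = R := by
    apply Finset.eq_of_subset_of_card_le
    · intro x hx
      simp only [Finset.mem_image] at hx
      obtain ⟨i, _, rfl⟩ := hx
      exact hrR i
    · rw [Finset.card_image_of_injective _ hrinj]; simp [hm]
  let F : Fin n → Fin n → Fin (m+2) → Fin n := fun x y =>
    (Fin.cons x (Fin.cons y r : Fin (m+1) → Fin n) : Fin (m+2) → Fin n)
  have hFinj : ∀ x y, x ∉ R → y ∉ R → x < y → Function.Injective (F x y) := by
    intro x y hx hy hxy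
    simp only [F]
    rw [Fin.cons_injective_iff, Fin.cons_injective_iff]
    refine ⟨?_, ?_, hrinj⟩
    · rintro ⟨i, hi⟩
      revert hi
      refine Fin.cases ?_ (fun j => ?_) i
      · simp [hxy.ne']
      · simp only [Fin.cons_succ]; rintro rfl; exact hx (hrR j)
    · rintro ⟨i, rfl⟩; exact hy (hrR i)
  have hFim : ∀ x y, Finset.univ.image (F x y) = insert x (insert y R) := by
    intro x y
    ext z
    simp only [F, Finset.mem_image, Finset.mem_univ, true_and, Fin.exists_fin_succ, Fin.cons_zero,
      Fin.cons_succ, Finset.mem_insert, ← hrim]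
    tauto
  let D : Fin n → Fin n → ℝ := fun x y => (A.submatrix id (F x y)).det
  have hbase : ∀ x y, x ∉ R → y ∉ R → x < y → (ℬ (insert x (insert y R)) ↔ D x y ≠ 0) := by
    intro x y hx hy hxy
    rw [← hFim]
    exact kc_base A hr _ (hFinj x y hx hy hxy)
  let w : Fin n → ℝ := fun x => ∏ i, (((r i : ℕ) : ℝ) - (x : ℕ))
  let V : ℝ := (Matrix.vandermonde (fun i => ((r i : ℕ) : ℝ))).det
  have hw : ∀ x, x ∉ R → w x ≠ 0 := by
    intro x hx
    refine Finset.prod_ne_zero_iff.2 fun i _ => ?_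
    rw [sub_ne_zero]
    intro h
    have : r i = x := Fin.ext (by exact_mod_cast h)
    exact hx (this ▸ hrR i)
  have hV : V ≠ 0 := by
    refine Matrix.det_vandermonde_ne_zero_iff.2 ?_
    intro i j hij
    have hij' : ((r i : ℕ) : ℝ) = ((r j : ℕ) : ℝ) := hij
    exact hrinj (Fin.ext (by exact_mod_cast hij'))
  have hnn : ∀ x y, x ∉ R → y ∉ R → x < y → 0 ≤ D x y * (w x * w y * V) := by
    intro x y hx hy hxy
    have := kc_sign A hA.2 _ (hFinj x y hx hy hxy)
    have hv : (Matrix.vandermonde (fun i => ((F x y i : ℕ) : ℝ))).det =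
        (((y : ℕ) : ℝ) - (x : ℕ)) * (w x * w y * V) := by
      simp only [V, w, Matrix.det_vandermonde, F]
      rw [Fin.prod_univ_succ, Fin.prod_univ_succ]
      simp only [Fin.prod_Ioi_zero, Fin.prod_Ioi_succ, Fin.cons_zero, Fin.cons_succ,
        Fin.prod_univ_succ (n := m)]
      ring
    rw [hv] at this
    have hpos : (0 : ℝ) < ((y : ℕ) : ℝ) - (x : ℕ) := by
      have : ((x : ℕ) : ℝ) < ((y : ℕ) : ℝ) := by exact_mod_cast hxy
      linarith
    have h' : 0 ≤ (((y : ℕ) : ℝ) - (x : ℕ)) * (D x y * (w x * w y * V)) := by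
      have e : (((y : ℕ) : ℝ) - (x : ℕ)) * (D x y * (w x * w y * V)) =
        (A.submatrix id (F x y)).det * ((((y : ℕ) : ℝ) - (x : ℕ)) * (w x * w y * V)) := by
        simp only [D]; ring
      rw [e]; exact this
    exact nonneg_of_mul_nonneg_right h' hpos
  have hpp : ∀ x y, x ∉ R → y ∉ R → x < y → ℬ (insert x (insert y R)) →
      0 < D x y * (w x * w y * V) := by
    intro x y hx hy hxy hB
    refine lt_of_le_of_ne (hnn x y hx hy hxy) (Ne.symm ?_)
    exact mul_ne_zero ((hbase x y hx hy hxy).1 hB)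
      (mul_ne_zero (mul_ne_zero (hw x hx) (hw y hy)) hV)
  have hanti : D c b = - D b c := by
    have := Matrix.det_permute' (Equiv.swap (0 : Fin (m+2)) 1) (A.submatrix id (F b c))
    rw [Equiv.Perm.sign_swap (by simp)] at this
    have e : (A.submatrix id (F b c)).submatrix id (Equiv.swap (0 : Fin (m+2)) 1)
        = A.submatrix id (F c b) := by
      ext i j
      refine Fin.cases ?_ (fun j => ?_) j
      · simp [F]
      · refine Fin.cases ?_ (fun j => ?_) j
        · simp [F]
        · rw [Matrix.submatrix_apply, Equiv.swap_apply_of_ne_of_ne (by simp [Fin.ext_iff])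
            (by simp [Fin.ext_iff])]
          simp [F]
    rw [e] at this
    simpa using this
  have hP := kc_pluecker A r a b c e D (fun _ _ => rfl)
  have hac : D a c = 0 := by
    by_contra h; exact h5 ((hbase a c haR hcR (hab.trans hbc)).2 h)
  rw [hac, hanti] at hP
  have p1 := hpp a b haR hbR hab h1
  have p2 := hpp c e hcR heR hce h2
  have p3 := hpp a e haR heR (hab.trans (hbc.trans hce)) h3
  have p4 := hpp b c hbR hcR hbc h4
  have q1 := mul_pos p1 p2
  have q2 := mul_pos p3 p4
  have : D a b * (w a * w b * V) * (D c e * (w c * w e * V)) +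
      D a e * (w a * w e * V) * (D b c * (w b * w c * V)) = 0 := by
    have : D a b * (w a * w b * V) * (D c e * (w c * w e * V)) +
      D a e * (w a * w e * V) * (D b c * (w b * w c * V)) =
      (D a b * D c e + D b c * D a e) * (w a * w b * w c * w e * V * V) := by ring
    rw [this, hP]; ring
  linarith

theorem kc_sub_val {m : ℕ} (a b : Fin m) :
    ((b - a : Fin m) : ℕ) = if a ≤ b then (b : ℕ) - a else m + b - a := by
  have ha := a.isLt
  have hb := b.isLt
  rw [Fin.sub_def]
  simp only [Fin.le_def]
  split_ifs with h
  · have : m - (a : ℕ) + b = (b - a) + m := by omega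
    rw [this, Nat.add_mod_right, Nat.mod_eq_of_lt (by omega)]
  · have : m - (a : ℕ) + b = m + b - a := by omega
    rw [this, Nat.mod_eq_of_lt (by omega)]

theorem kc_cyc {m : ℕ} (a b c d : Fin m) : Cyc4 a b c d ↔
    (a < b ∧ b < c ∧ c < d) ∨ (b < c ∧ c < d ∧ d < a) ∨ (c < d ∧ d < a ∧ a < b) ∨
      (d < a ∧ a < b ∧ b < c) := by
  unfold Cyc4
  rw [kc_sub_val, kc_sub_val, kc_sub_val]
  simp only [Fin.le_def, Fin.lt_def]
  have := a.isLt
  have := b.isLt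
  have := c.isLt
  have := d.isLt
  split_ifs <;> omega

theorem kc_noncross {m : ℕ} (P : Set (Set (Fin m))) : NonCrossingSetP P ↔
    ∀ S ∈ P, ∀ T ∈ P, S ≠ T → ∀ a b c d : Fin m, a < b → b < c → c < d →
      a ∈ S → c ∈ S → b ∈ T → d ∈ T → False := by
  unfold NonCrossingSetP
  constructor
  · intro h S hS T hT hne a b c d hab hbc hcd ha hc hb hd
    exact h ⟨S, hS, T, hT, hne, a, b, c, d, ha, hc, hb, hd, (kc_cyc _ _ _ _).2 (Or.inl ⟨hab, hbc, hcd⟩)⟩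
  · rintro h ⟨S, hS, T, hT, hne, a, b, c, d, ha, hc, hb, hd, hcyc⟩
    rcases (kc_cyc _ _ _ _).1 hcyc with ⟨h1, h2, h3⟩ | ⟨h1, h2, h3⟩ | ⟨h1, h2, h3⟩ | ⟨h1, h2, h3⟩
    · exact h S hS T hT hne a b c d h1 h2 h3 ha hc hb hd
    · exact h T hT S hS hne.symm b c d a h1 h2 h3 hb hd hc ha
    · exact h S hS T hT hne c d a b h1 h2 h3 hc ha hd hb
    · exact h T hT S hS hne.symm d a b c h1 h2 h3 hd hb ha hc

/-- the abstract combinatorial statement -/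
theorem kc_combi {n t : ℕ} (S : Fin t → Finset (Fin n))
    (hpp : ∀ k l, k ≠ l → ∀ a b c d : Fin n, a < b → b < c → c < d →
      a ∈ S k → c ∈ S k → b ∈ S l → d ∈ S l → False)
    (R : Fin n → Fin n → Prop) (hequiv : Equivalence R)
    (hR : ∀ i j, R i j ↔ ∀ k, ∀ x ∈ S k, ∀ y ∈ S k, ((x ≤ i ↔ y ≤ i) ↔ (x ≤ j ↔ y ≤ j))) :
    IsKrewerasComplement {T : Set (Fin n) | ∃ i : Fin t, T = ↑(S i)}
        {T : Set (Fin n) | ∃ i : Fin n, T = {j | R i j}} ∧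
      NonCrossingSetP {T : Set (Fin n) | ∃ i : Fin n, T = {j | R i j}} := by
  have hclass : ∀ i j, R i j → {x | R i x} = {x | R j x} := by
    intro i j hij
    ext x
    exact ⟨fun h => hequiv.trans (hequiv.symm hij) h, fun h => hequiv.trans hij h⟩
  have hKK : ∀ i j, {x | R i x} ≠ {x | R j x} → ∀ a b c d : Fin n, a < b → b < c → c < d →
      R i a → R i c → R j b → R j d → False := by
    intro i j hne a b c d hab hbc hcd hia hic hjb hjd
    apply hne
    have hac := (hR _ _).1 (hequiv.trans (hequiv.symm hia) hic)
    have hbd := (hR _ _).1 (hequiv.trans (hequiv.symm hjb) hjd)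
    have : R b c := by
      rw [hR]
      intro k x hx y hy
      have h1 := hac k x hx y hy
      have h2 := hbd k x hx y hy
      simp only [Fin.le_def, Fin.lt_def] at *
      omega
    exact hclass _ _ (hequiv.trans hic (hequiv.trans (hequiv.symm this) (hequiv.symm hjb)))
  refine ⟨⟨⟨?_, ?_⟩, ?_, ?_⟩, ?_⟩
  · rintro _ ⟨i, rfl⟩
    exact ⟨i, hequiv.refl i⟩
  · intro x
    refine ⟨{j | R x j}, ⟨⟨x, rfl⟩, hequiv.refl x⟩, ?_⟩
    rintro _ ⟨⟨i, rfl⟩, hi⟩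
    exact hclass i x hi
  · rw [kc_noncross]
    rintro _ (⟨_, ⟨k, rfl⟩, rfl⟩ | ⟨_, ⟨i, rfl⟩, rfl⟩) _ (⟨_, ⟨l, rfl⟩, rfl⟩ | ⟨_, ⟨j, rfl⟩, rfl⟩)
      hne _ _ _ _ hab hbc hcd ⟨a, ha, rfl⟩ ⟨c, hc, rfl⟩ ⟨b, hb, rfl⟩ ⟨d, hd, rfl⟩
    · refine hpp k l (by rintro rfl; exact hne rfl) a b c d ?_ ?_ ?_ ha hc hb hd <;>
        simp only [Fin.lt_def, evenEmb] at * <;> omega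
    · have hbd := (hR _ _).1 (hequiv.trans (hequiv.symm hb) hd) k a ha c hc
      simp only [Fin.lt_def, Fin.le_def, evenEmb, oddEmb] at *
      omega
    · have hac := (hR _ _).1 (hequiv.trans (hequiv.symm ha) hc) l b hb d hd
      simp only [Fin.lt_def, Fin.le_def, evenEmb, oddEmb] at *
      omega
    · refine hKK i j (by intro h; apply hne; simp only [h]) a b c d ?_ ?_ ?_ ha hc hb hd <;>
        simp only [Fin.lt_def, oddEmb] at * <;> omega
  · intro Q hQ hnc T hT
    rw [kc_noncross] at hnc
    obtain ⟨i, hi⟩ := hQ.1 T hT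
    have main : ∀ p ∈ T, ∀ q ∈ T, p < q → R p q := by
      intro p hp q hq hpq
      have hcr : ∀ k, ∀ x ∈ S k, ∀ y ∈ S k, p < x → x ≤ q → (y ≤ p ∨ q < y) → False := by
        intro k x hx y hy hpx hxq hyy
        have hS : evenEmb n '' (S k : Set (Fin n)) ∈
            interleave {T : Set (Fin n) | ∃ i : Fin t, T = ↑(S i)} Q :=
          Or.inl ⟨_, ⟨k, rfl⟩, rfl⟩
        have hT' : oddEmb n '' T ∈
            interleave {T : Set (Fin n) | ∃ i : Fin t, T = ↑(S i)} Q :=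
          Or.inr ⟨_, hT, rfl⟩
        have hne : evenEmb n '' (S k : Set (Fin n)) ≠ oddEmb n '' T := by
          intro h
          have : evenEmb n x ∈ oddEmb n '' T := h ▸ ⟨x, hx, rfl⟩
          obtain ⟨z, _, hz⟩ := this
          simp only [Fin.ext_iff, evenEmb, oddEmb] at hz
          omega
        rcases hyy with hy' | hy'
        · refine hnc _ hS _ hT' hne (evenEmb n y) (oddEmb n p) (evenEmb n x) (oddEmb n q)
            ?_ ?_ ?_ ⟨y, hy, rfl⟩ ⟨x, hx, rfl⟩ ⟨p, hp, rfl⟩ ⟨q, hq, rfl⟩ <;>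
          simp only [Fin.lt_def, Fin.le_def, evenEmb, oddEmb] at * <;> omega
        · refine hnc _ hT' _ hS hne.symm (oddEmb n p) (evenEmb n x) (oddEmb n q) (evenEmb n y)
            ?_ ?_ ?_ ⟨p, hp, rfl⟩ ⟨q, hq, rfl⟩ ⟨x, hx, rfl⟩ ⟨y, hy, rfl⟩ <;>
          simp only [Fin.lt_def, Fin.le_def, evenEmb, oddEmb] at * <;> omega
      rw [hR]
      intro k x hx y hy
      have h1 : ¬ (p < x ∧ x ≤ q ∧ (y ≤ p ∨ q < y)) :=
        fun h => hcr k x hx y hy h.1 h.2.1 h.2.2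
      have h2 : ¬ (p < y ∧ y ≤ q ∧ (x ≤ p ∨ q < x)) :=
        fun h => hcr k y hy x hx h.1 h.2.1 h.2.2
      clear hcr
      simp only [Fin.lt_def, Fin.le_def] at *
      omega
    refine ⟨_, ⟨i, rfl⟩, ?_⟩
    intro j hj
    rcases lt_trichotomy i j with h | h | h
    · exact main i hi j hj h
    · subst h; exact hequiv.refl _
    · exact hequiv.symm (main j hj i hi h)
  · rw [kc_noncross]
    rintro _ ⟨i, rfl⟩ _ ⟨j, rfl⟩ hne a b c d hab hbc hcd ha hc hb hd
    exact hKK i j hne a b c d hab hbc hcd ha hc hb hd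

theorem kc_ySum {n : ℕ} (B : Finset (Fin n)) (i : Fin n) :
    ySum (fun k => if k ∈ B then (1 : ℝ) else 0) i = ((B.filter (fun k => k ≤ i)).card : ℝ) := by
  unfold ySum
  rw [Finset.sum_boole]
  congr 2
  ext k
  simp [and_comm]

theorem kc_const {n : ℕ} (ℬ : Finset (Fin n) → Prop) (i j : Fin n) (hex : ∃ B, ℬ B) :
    (∃ c : ℝ, ∀ x ∈ matroidPolytope ℬ, ySum x j - ySum x i = c) ↔
    ∀ B B', ℬ B → ℬ B' →
      ((B.filter (fun k => k ≤ j)).card : ℤ) - (B.filter (fun k => k ≤ i)).card =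
      (B'.filter (fun k => k ≤ j)).card - (B'.filter (fun k => k ≤ i)).card := by
  constructor
  · rintro ⟨c, hc⟩ B B' hB hB'
    have h1 := hc _ (subset_convexHull ℝ _ ⟨B, hB, rfl⟩)
    have h2 := hc _ (subset_convexHull ℝ _ ⟨B', hB', rfl⟩)
    rw [kc_ySum, kc_ySum] at h1 h2
    have := h1.trans h2.symm
    exact_mod_cast this
  · intro h
    obtain ⟨B₀, hB₀⟩ := hex
    refine ⟨((B₀.filter (fun k => k ≤ j)).card : ℝ) - (B₀.filter (fun k => k ≤ i)).card, ?_⟩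
    have hsub : matroidPolytope ℬ ⊆ {x | ySum x j - ySum x i =
        ((B₀.filter (fun k => k ≤ j)).card : ℝ) - (B₀.filter (fun k => k ≤ i)).card} := by
      apply convexHull_min
      · rintro _ ⟨B, hB, rfl⟩
        simp only [Set.mem_ofPred_eq, kc_ySum]
        exact_mod_cast h B B₀ hB hB₀
      · intro x hx y hy a b ha hb hab
        simp only [Set.mem_ofPred_eq] at *
        have : ∀ i, ySum (a • x + b • y) i = a * ySum x i + b * ySum y i := by
          intro i
          simp [ySum, Finset.sum_add_distrib, Finset.mul_sum]
        rw [this, this]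
        linear_combination a * hx + b * hy + (((B₀.filter (fun k => k ≤ j)).card : ℝ) - (B₀.filter (fun k => k ≤ i)).card) * hab
    exact fun x hx => hsub hx

theorem kc_count {n : ℕ} (B : Finset (Fin n)) (p q i : Fin n) (hp : p ∈ B) (hq : q ∉ B) :
    (((insert q (B.erase p)).filter (fun k => k ≤ i)).card : ℤ) + (if p ≤ i then 1 else 0) =
      (B.filter (fun k => k ≤ i)).card + (if q ≤ i then 1 else 0) := by
  have h1 : ∀ X : Finset (Fin n), ((X.filter (fun k => k ≤ i)).card : ℤ) =
      ∑ k ∈ X, if k ≤ i then 1 else 0 := by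
    intro X; rw [Finset.card_filter]; push_cast; rfl
  rw [h1, h1, Finset.sum_insert (by simp [hq]), ← Finset.sum_erase_add B _ hp]
  ring

theorem kc_diff {n : ℕ} (B : Finset (Fin n)) (i j : Fin n) (h : i ≤ j) :
    ((B.filter (fun k => k ≤ j)).card : ℤ) - (B.filter (fun k => k ≤ i)).card =
      (B.filter (fun k => ¬ (k ≤ i ↔ k ≤ j))).card := by
  have : (B.filter (fun k => k ≤ j)) =
      (B.filter (fun k => k ≤ i)) ∪ (B.filter (fun k => ¬ (k ≤ i ↔ k ≤ j))) := by
    ext k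
    simp only [Finset.mem_filter, Finset.mem_union, Fin.le_def] at *
    by_cases hk : k ∈ B
    · simp only [hk, true_and]; omega
    · simp [hk]
  rw [this, Finset.card_union_of_disjoint]
  · push_cast; ring
  · rw [Finset.disjoint_left]
    intro k
    simp only [Finset.mem_filter, Fin.le_def] at *
    rintro ⟨_, h1⟩ ⟨_, h2⟩
    omega

set_option maxHeartbeats 4000000 in
/-- Components of a positroid do not cross. -/
theorem kc_pp {n t : ℕ} {ℬ : Finset (Fin n) → Prop}
    {S : Fin t → Finset (Fin n)} {ℬᵢ : Fin t → Finset (Fin n) → Prop}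
    (hpos : IsPositroid ℬ)
    (hdisj : ∀ k l x, x ∈ S k → x ∈ S l → k = l)
    (hsupp : ∀ i B, ℬᵢ i B → B ⊆ S i)
    (hmat : ∀ i, IsBasesSet (ℬᵢ i))
    (hconn : ∀ i, MatroidConnected (toSubtypePred (S i) (ℬᵢ i)))
    (hcov : ∀ x, ∃ k, x ∈ S k)
    (hB : ∀ X, ℬ X ↔ ∀ k, ℬᵢ k (X ∩ S k))
    (k l : Fin t) (hkl : k ≠ l) (a b c d : Fin n) (hab : a < b) (hbc : b < c) (hcd : c < d)
    (ha : a ∈ S k) (hc : c ∈ S k) (hb : b ∈ S l) (hd : d ∈ S l) : False := by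
  obtain ⟨r, A, hA, hr⟩ := hpos
  obtain ⟨C, p, q, hC, hp, hq, hC', hpq⟩ := kc_exchange (hmat k) (hsupp k) (hconn k)
    (Finset.Ioc b d) c a hc ha (by simp [hbc, hcd.le]) (by simp [hab.le])
  have hpS := hsupp k _ hC hp
  have hqS := hsupp k _ hC' (Finset.mem_insert_self _ _)
  have hne : ∀ x ∈ S k, ∀ y ∈ S l, x ≠ y := by
    rintro x hx y hy rfl; exact hkl (hdisj _ _ _ hx hy)
  have hpq' : p ≠ q := by rintro rfl; exact hq hp
  have hsep : ∃ C p' q', ℬᵢ l C ∧ p' ∈ C ∧ q' ∉ C ∧ ℬᵢ l (insert q' (C.erase p')) ∧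
      ¬ (p' ∈ Finset.Ioc (min p q) (max p q) ↔ q' ∈ Finset.Ioc (min p q) (max p q)) := by
    have h1 := hne p hpS b hb
    have h2 := hne p hpS d hd
    have h3 := hne q hqS b hb
    have h4 := hne q hqS d hd
    by_cases hbU : b ∈ Finset.Ioc (min p q) (max p q)
    · refine kc_exchange (hmat l) (hsupp l) (hconn l) _ b d hb hd hbU ?_
      simp only [Finset.mem_Ioc, min_lt_iff, le_max_iff, Fin.lt_def, Fin.le_def, ne_eq, Fin.ext_iff]
        at *
      omega
    · refine kc_exchange (hmat l) (hsupp l) (hconn l) _ d b hd hb ?_ hbU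
      simp only [Finset.mem_Ioc, min_lt_iff, le_max_iff, Fin.lt_def, Fin.le_def, ne_eq, Fin.ext_iff]
        at *
      omega
  obtain ⟨C₂, p', q', hC₂, hp', hq', hC₂', hpq2⟩ := hsep
  have hpS' := hsupp l _ hC₂ hp'
  have hqS' := hsupp l _ hC₂' (Finset.mem_insert_self _ _)
  have n1 := hne p hpS p' hpS'
  have n2 := hne p hpS q' hqS'
  have n3 := hne q hqS p' hpS'
  have n4 := hne q hqS q' hqS'
  have n5 : p' ≠ q' := by rintro rfl; exact hq' hp'
  choose F hF using fun i => (hmat i).1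
  have hmem : ∀ i x, x ∈ F i → x ∈ S i := fun i x hx => hsupp i _ (hF i) hx
  let G : Fin t → Finset (Fin n) := fun i => if i = k then C else if i = l then C₂ else F i
  have hGk : G k = C := by simp [G]
  have hGl : G l = C₂ := by simp [G, hkl.symm]
  have hG : ∀ i, ℬᵢ i (G i) := by
    intro i
    simp only [G]
    split_ifs with h1 h2
    · subst h1; exact hC
    · subst h2; exact hC₂
    · exact hF i
  let B : Finset (Fin n) := Finset.univ.biUnion G
  have hBS : ∀ i, B ∩ S i = G i := by
    intro i
    ext x
    simp only [B, Finset.mem_inter, Finset.mem_biUnion, Finset.mem_univ, true_and]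
    constructor
    · rintro ⟨⟨j, hj⟩, hx⟩
      have := hdisj j i x (hsupp j _ (hG j) hj) hx
      subst this; exact hj
    · intro hx; exact ⟨⟨i, hx⟩, hsupp i _ (hG i) hx⟩
  have hBmem : ∀ i x, x ∈ S i → (x ∈ B ↔ x ∈ G i) := by
    intro i x hx
    rw [← hBS i]; simp [hx]
  have hpB : p ∈ B := (hBmem k p hpS).2 (hGk ▸ hp)
  have hqB : q ∉ B := fun h => hq (hGk ▸ (hBmem k q hqS).1 h)
  have hpB' : p' ∈ B := (hBmem l p' hpS').2 (hGl ▸ hp')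
  have hqB' : q' ∉ B := fun h => hq' (hGl ▸ (hBmem l q' hqS').1 h)
  have hBb : ℬ B := by rw [hB]; intro i; rw [hBS]; exact hG i
  have htest : ∀ X : Finset (Fin n), ℬᵢ k (X ∩ S k) → ℬᵢ l (X ∩ S l) →
      (∀ x, x ∉ S k → x ∉ S l → (x ∈ X ↔ x ∈ B)) → ℬ X := by
    intro X h1 h2 h3
    rw [hB]
    intro i
    by_cases hik : i = k
    · subst hik; exact h1
    by_cases hil : i = l
    · subst hil; exact h2
    have : X ∩ S i = G i := by
      rw [← hBS i]
      ext x
      simp only [Finset.mem_inter]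
      constructor
      · rintro ⟨hx, hxi⟩
        exact ⟨(h3 x (fun h => hik (hdisj _ _ _ hxi h)) (fun h => hil (hdisj _ _ _ hxi h))).1 hx, hxi⟩
      · rintro ⟨hx, hxi⟩
        exact ⟨(h3 x (fun h => hik (hdisj _ _ _ hxi h)) (fun h => hil (hdisj _ _ _ hxi h))).2 hx, hxi⟩
    rw [this]; exact hG i
  have hSk : ∀ x, x ∈ S k → x ∉ S l := fun x h1 h2 => hkl (hdisj _ _ _ h1 h2)
  have hCm : ∀ x, x ∈ C ↔ x ∈ B ∧ x ∈ S k := by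
    intro x; rw [← hGk, ← hBS k, Finset.mem_inter]
  have hCm2 : ∀ x, x ∈ C₂ ↔ x ∈ B ∧ x ∈ S l := by
    intro x; rw [← hGl, ← hBS l, Finset.mem_inter]
  set R := (B.erase p).erase p' with hR
  have hRm : ∀ x, x ∈ R ↔ x ≠ p' ∧ x ≠ p ∧ x ∈ B := by
    intro x; simp [hR]
  have b1 : ℬ (insert p (insert p' R)) := by
    have : insert p (insert p' R) = B := by
      ext x; simp only [Finset.mem_insert, hRm]; grind
    rw [this]; exact hBb
  have b2 : ℬ (insert p (insert q' R)) := by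
    apply htest
    · have : insert p (insert q' R) ∩ S k = C := by
        ext x; simp only [Finset.mem_inter, Finset.mem_insert, hRm, hCm]; grind
      rw [this]; exact hC
    · have : insert p (insert q' R) ∩ S l = insert q' (C₂.erase p') := by
        ext x; simp only [Finset.mem_inter, Finset.mem_insert, Finset.mem_erase, hRm, hCm2]; grind
      rw [this]; exact hC₂'
    · intro x h1 h2; simp only [Finset.mem_insert, hRm]; grind
  have b3 : ℬ (insert q (insert p' R)) := by
    apply htest
    · have : insert q (insert p' R) ∩ S k = insert q (C.erase p) := by
        ext x; simp only [Finset.mem_inter, Finset.mem_insert, Finset.mem_erase, hRm, hCm]; grind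
      rw [this]; exact hC'
    · have : insert q (insert p' R) ∩ S l = C₂ := by
        ext x; simp only [Finset.mem_inter, Finset.mem_insert, hRm, hCm2]; grind
      rw [this]; exact hC₂
    · intro x h1 h2; simp only [Finset.mem_insert, hRm]; grind
  have b4 : ℬ (insert q (insert q' R)) := by
    apply htest
    · have : insert q (insert q' R) ∩ S k = insert q (C.erase p) := by
        ext x; simp only [Finset.mem_inter, Finset.mem_insert, Finset.mem_erase, hRm, hCm]; grind
      rw [this]; exact hC'
    · have : insert q (insert q' R) ∩ S l = insert q' (C₂.erase p') := by
        ext x; simp only [Finset.mem_inter, Finset.mem_insert, Finset.mem_erase, hRm, hCm2]; grind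
      rw [this]; exact hC₂'
    · intro x h1 h2; simp only [Finset.mem_insert, hRm]; grind
  have hcard : ∀ X, ℬ X → X.card = r := fun X h => ((hr X).1 h).1
  have b5 : ¬ ℬ (insert p (insert q R)) := by
    intro h
    have h' := (hB _).1 h k
    have : ℬ (insert q B) := by
      apply htest
      · have : insert q B ∩ S k = insert p (insert q R) ∩ S k := by
          ext x; simp only [Finset.mem_inter, Finset.mem_insert, hRm]; grind
        rw [this]; exact h'
      · have : insert q B ∩ S l = C₂ := by
          ext x; simp only [Finset.mem_inter, Finset.mem_insert, hCm2]; grind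
        rw [this]; exact hC₂
      · intro x h1 h2; simp only [Finset.mem_insert]; grind
    have h1 := hcard _ this
    have h2 := hcard _ hBb
    rw [Finset.card_insert_of_notMem hqB] at h1
    omega
  have b6 : ¬ ℬ (insert p' (insert q' R)) := by
    intro h
    have h' := (hB _).1 h l
    have : ℬ (insert q' B) := by
      apply htest
      · have : insert q' B ∩ S k = C := by
          ext x; simp only [Finset.mem_inter, Finset.mem_insert, hCm]; grind
        rw [this]; exact hC
      · have : insert q' B ∩ S l = insert p' (insert q' R) ∩ S l := by
          ext x; simp only [Finset.mem_inter, Finset.mem_insert, hRm]; grind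
        rw [this]; exact h'
      · intro x h1 h2; simp only [Finset.mem_insert]; grind
    have h1 := hcard _ this
    have h2 := hcard _ hBb
    rw [Finset.card_insert_of_notMem hqB'] at h1
    omega
  have hcomm : ∀ x y, insert x (insert y R) = insert y (insert x R) :=
    fun x y => Finset.insert_comm x y R
  have r1 : p ∉ R := by simp [hR]
  have r2 : p' ∉ R := by simp [hR]
  have r3 : q ∉ R := fun h => hqB ((hRm q).1 h).2.2
  have r4 : q' ∉ R := fun h => hqB' ((hRm q').1 h).2.2
  have hcases : (p < p' ∧ p' < q ∧ q < q') ∨ (p < q' ∧ q' < q ∧ q < p') ∨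
      (q < p' ∧ p' < p ∧ p < q') ∨ (q < q' ∧ q' < p ∧ p < p') ∨
      (p' < p ∧ p < q' ∧ q' < q) ∨ (p' < q ∧ q < q' ∧ q' < p) ∨
      (q' < p ∧ p < p' ∧ p' < q) ∨ (q' < q ∧ q < p' ∧ p' < p) := by
    clear * - hpq2 n1 n2 n3 n4 n5 hpq'
    simp only [Finset.mem_Ioc, min_lt_iff, le_max_iff, Fin.lt_def, Fin.le_def, ne_eq, Fin.ext_iff]
      at *
    omega
  have key := kc_contra A hA hr R
  rcases hcases with ⟨h1, h2, h3⟩ | ⟨h1, h2, h3⟩ | ⟨h1, h2, h3⟩ | ⟨h1, h2, h3⟩ | ⟨h1, h2, h3⟩ |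
    ⟨h1, h2, h3⟩ | ⟨h1, h2, h3⟩ | ⟨h1, h2, h3⟩ <;>
  refine key _ _ _ _ h1 h2 h3 ?_ ?_ ?_ ?_ ?_ ?_ ?_ ?_ ?_ <;>
  first
  | assumption
  | (rw [hcomm]; assumption)

/-- Let `M` be a positroid on `[n]`, with decomposition into
connected components on the blocks `S₁, ..., S_t` (so `Π_M = {S₁, ..., S_t}` is
the partition of `[n]` into the ground sets of the connected components of
`M`).  Define `i ∼* j` iff `y_j - y_i` is constant on `Γ_M` (where
`y_i = x_1 + ... + x_i`), and let `Π*_M` be the partition of `[n]` into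
`∼*`-equivalence classes.  Then `Π*_M` is the Kreweras complement `K(Π_M)`;
in particular, `Π*_M` is non-crossing. -/
theorem kreweras_complement_of_positroid (n t : ℕ) (ℬ : Finset (Fin n) → Prop)
    (S : Fin t → Finset (Fin n)) (ℬᵢ : Fin t → Finset (Fin n) → Prop)
    (hpos : IsPositroid ℬ)
    (hne : ∀ i, (S i).Nonempty)
    (hpart : ∀ x : Fin n, ∃! i, x ∈ S i)
    (hsupp : ∀ i B, ℬᵢ i B → B ⊆ S i)
    (hmat : ∀ i, IsBasesSet (ℬᵢ i))
    (hconn : ∀ i, MatroidConnected (toSubtypePred (S i) (ℬᵢ i)))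
    (hsum : ∀ B, ℬ B ↔ ∃ f : Fin t → Finset (Fin n),
      (∀ i, ℬᵢ i (f i)) ∧ B = Finset.univ.biUnion f) :
    IsKrewerasComplement {T : Set (Fin n) | ∃ i : Fin t, T = ↑(S i)}
        {T : Set (Fin n) | ∃ i : Fin n,
          T = {j | ∃ c : ℝ, ∀ x ∈ matroidPolytope ℬ, ySum x j - ySum x i = c}} ∧
      NonCrossingSetP {T : Set (Fin n) | ∃ i : Fin n,
        T = {j | ∃ c : ℝ, ∀ x ∈ matroidPolytope ℬ, ySum x j - ySum x i = c}} := by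
  
  have hdisj : ∀ k l x, x ∈ S k → x ∈ S l → k = l :=
    fun k l x h1 h2 => (hpart x).unique h1 h2
  have hcov : ∀ x, ∃ k, x ∈ S k := fun x => (hpart x).exists
  have hB : ∀ X, ℬ X ↔ ∀ k, ℬᵢ k (X ∩ S k) := by
    intro X
    rw [hsum]
    constructor
    · rintro ⟨f, hf, rfl⟩ k
      have : Finset.univ.biUnion f ∩ S k = f k := by
        ext x
        simp only [Finset.mem_inter, Finset.mem_biUnion, Finset.mem_univ, true_and]
        constructor
        · rintro ⟨⟨j, hj⟩, hx⟩
          have := hdisj j k x (hsupp j _ (hf j) hj) hx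
          subst this; exact hj
        · intro hx; exact ⟨⟨k, hx⟩, hsupp k _ (hf k) hx⟩
      rw [this]; exact hf k
    · intro h
      refine ⟨fun k => X ∩ S k, h, ?_⟩
      ext x
      simp only [Finset.mem_inter, Finset.mem_biUnion, Finset.mem_univ, true_and]
      obtain ⟨k, hk⟩ := hcov x
      exact ⟨fun hx => ⟨k, hx, hk⟩, fun ⟨_, hx, _⟩ => hx⟩
  have hex : ∃ B, ℬ B := by
    choose F hF using fun i => (hmat i).1
    exact ⟨_, (hsum _).2 ⟨F, hF, rfl⟩⟩
  have hcard : ∃ r, ∀ X, ℬ X → X.card = r := by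
    obtain ⟨r, A, hA, hr⟩ := hpos
    exact ⟨r, fun X h => ((hr X).1 h).1⟩
  obtain ⟨r, hcard⟩ := hcard
  refine kc_combi S (kc_pp hpos hdisj hsupp hmat hconn hcov hB)
    (fun i j => ∃ c : ℝ, ∀ x ∈ matroidPolytope ℬ, ySum x j - ySum x i = c) ?_ ?_
  · refine ⟨fun i => ⟨0, fun x _ => sub_self _⟩, ?_, ?_⟩
    · rintro i j ⟨c, hc⟩
      exact ⟨-c, fun x hx => by have := hc x hx; linarith⟩
    · rintro i j k ⟨c, hc⟩ ⟨c', hc'⟩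
      exact ⟨c + c', fun x hx => by have := hc x hx; have := hc' x hx; linarith⟩
  · intro i j
    rw [kc_const ℬ i j hex]
    constructor
    · intro h k
      obtain ⟨B₀, hB₀⟩ := hex
      let U : Finset (Fin n) := Finset.univ.filter (fun z => ¬ (z ≤ i ↔ z ≤ j))
      have main : ∀ x ∈ S k, ∀ y ∈ S k, x ∈ U → y ∉ U → False := by
        intro x hx y hy hxU hyU
        obtain ⟨C, p, q, hC, hp, hq, hC', hpq⟩ := kc_exchange (hmat k) (hsupp k) (hconn k)
          U x y hx hy hxU hyU
        have hpS := hsupp k _ hC hp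
        have hqS := hsupp k _ hC' (Finset.mem_insert_self _ _)
        have hglue : ∀ D, ℬᵢ k D → ℬ ((B₀ \ S k) ∪ D) := by
          intro D hD
          have hDS := hsupp k _ hD
          rw [hB]
          intro l
          by_cases hl : l = k
          · subst hl
            have : (B₀ \ S l ∪ D) ∩ S l = D := by
              ext z
              have := @hDS z
              simp only [Finset.mem_inter, Finset.mem_union, Finset.mem_sdiff]
              tauto
            rw [this]; exact hD
          · have : (B₀ \ S k ∪ D) ∩ S l = B₀ ∩ S l := by
              ext z
              have := @hDS z
              have hz : z ∈ S l → z ∉ S k := fun h1 h2 => hl (hdisj _ _ _ h1 h2)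
              simp only [Finset.mem_inter, Finset.mem_union, Finset.mem_sdiff]
              tauto
            rw [this]; exact (hB _).1 hB₀ l
        have h1 := hglue _ hC
        have h2 := hglue _ hC'
        have e : (B₀ \ S k) ∪ insert q (C.erase p) = insert q (((B₀ \ S k) ∪ C).erase p) := by
          ext z
          simp only [Finset.mem_union, Finset.mem_sdiff, Finset.mem_insert, Finset.mem_erase]
          grind
        rw [e] at h2
        have hpB : p ∈ (B₀ \ S k) ∪ C := by simp [hp]
        have hqB : q ∉ (B₀ \ S k) ∪ C := by simp [hq, hqS]
        have h3 := h _ _ h1 h2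
        have c1 := kc_count _ p q i hpB hqB
        have c2 := kc_count _ p q j hpB hqB
        apply hpq
        simp only [U, Finset.mem_filter, Finset.mem_univ, true_and]
        generalize (((insert q (((B₀ \ S k) ∪ C).erase p)).filter (fun k => k ≤ i)).card : ℤ) = w1 at *
        generalize (((insert q (((B₀ \ S k) ∪ C).erase p)).filter (fun k => k ≤ j)).card : ℤ) = w2 at *
        clear * - c1 c2 h3
        simp only [Fin.le_def] at *
        split_ifs at c1 c2 <;> omega
      intro x hx y hy
      have m1 := main x hx y hy
      have m2 := main y hy x hx
      simp only [U, Finset.mem_filter, Finset.mem_univ, true_and] at m1 m2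
      tauto
    · intro h B B' hBB hBB'
      have hX : ℬ (B.filter (fun k => ¬ (k ≤ i ↔ k ≤ j)) ∪ B'.filter (fun k => (k ≤ i ↔ k ≤ j))) := by
        rw [hB]
        intro k
        by_cases hU : ∃ x ∈ S k, ¬ (x ≤ i ↔ x ≤ j)
        · obtain ⟨x, hx, hxU⟩ := hU
          have : (B.filter (fun k => ¬ (k ≤ i ↔ k ≤ j)) ∪ B'.filter (fun k => (k ≤ i ↔ k ≤ j))) ∩ S k
              = B ∩ S k := by
            ext z
            simp only [Finset.mem_inter, Finset.mem_union, Finset.mem_filter]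
            have := fun hz => h k x hx z hz
            tauto
          rw [this]; exact (hB _).1 hBB k
        · push Not at hU
          have : (B.filter (fun k => ¬ (k ≤ i ↔ k ≤ j)) ∪ B'.filter (fun k => (k ≤ i ↔ k ≤ j))) ∩ S k
              = B' ∩ S k := by
            ext z
            simp only [Finset.mem_inter, Finset.mem_union, Finset.mem_filter]
            have := hU z
            tauto
          rw [this]; exact (hB _).1 hBB' k
      have c1 := hcard _ hX
      have c2 := hcard _ hBB'
      rw [Finset.card_union_of_disjoint (by
        rw [Finset.disjoint_left]; intro z; simp only [Finset.mem_filter]; tauto)] at c1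
      rw [← Finset.card_filter_add_card_filter_not (fun k => (k ≤ i ↔ k ≤ j))] at c2
      rcases le_total i j with hij | hij
      · rw [kc_diff _ _ _ hij, kc_diff _ _ _ hij]
        omega
      · have d1 := kc_diff B _ _ hij
        have d2 := kc_diff B' _ _ hij
        have es : ∀ X : Finset (Fin n), X.filter (fun k => ¬ (k ≤ j ↔ k ≤ i)) =
            X.filter (fun k => ¬ (k ≤ i ↔ k ≤ j)) := by
          intro X; ext z; simp only [Finset.mem_filter]; tauto
        rw [es] at d1 d2
        omega
end

section
/- Let M be a rank-d positroid on [n]. Every nonempty face F of Γ_M equals Γ_{N} for a unique positroid N = N(F) on [n], and the map sending each nonempty face F to the weighted non-crossing partition Π^w_{N(F)} (whose blocks are the ground sets of the connected components of N(F), each weighted by its rank in N(F)) and sending the empty face to 0̂ is an embedding of the face poset of Γ_M as an induced subposet of NC_n^d ∪ {0̂}: the map is injective, and for faces F and G one has F ⊆ G if and only if the image of F is less than or equal to the image of G in NC_n^d ∪ {0̂}. -/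
open Finset

/-- `F` is a face of the convex set `K ⊆ ℝ^n`: the empty set, `K` itself, or
the set of points of `K` minimizing some linear functional. -/
def IsFace {n : ℕ} (K F : Set (Fin n → ℝ)) : Prop :=
  F = ∅ ∨ F = K ∨ ∃ w : (Fin n → ℝ) →ₗ[ℝ] ℝ, F = {x ∈ K | ∀ y ∈ K, w x ≤ w y}

/-- The restriction of the matroid with bases `ℬ` to a block `S` of a direct
sum decomposition, as a matroid on the ground set `S`: its bases are the
intersections `B ∩ S` over bases `B` of `ℬ`. -/
def blockBases {n : ℕ} (ℬ : Finset (Fin n) → Prop) (S : Finset (Fin n)) :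
    Finset {x : Fin n // x ∈ S} → Prop :=
  fun C => ∃ B, ℬ B ∧ C.map (Function.Embedding.subtype fun x => x ∈ S) = B ∩ S

/-- `P` (a finite set of pairs (block, weight)) records the decomposition of
the matroid `ℬ` into connected components: the blocks partition `[n]`, `ℬ` is
the direct sum of its restrictions to the blocks, each restriction is
connected, and the weight of each block is its rank (the size of the
intersection of any basis with the block). -/
def IsWeightedCompPartition {n : ℕ} (ℬ : Finset (Fin n) → Prop)
    (P : Finset (Finset (Fin n) × ℕ)) : Prop :=
  (∀ x : Fin n, ∃! p, p ∈ P ∧ x ∈ p.1) ∧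
  (∀ p ∈ P, (Prod.fst p).Nonempty) ∧
  (∀ B, ℬ B ↔ ∀ p ∈ P, ∃ B', ℬ B' ∧ B ∩ (Prod.fst p) = B' ∩ (Prod.fst p)) ∧
  (∀ p ∈ P, MatroidConnected (blockBases ℬ (Prod.fst p))) ∧
  (∀ p ∈ P, ∀ B, ℬ B → (B ∩ (Prod.fst p)).card = Prod.snd p)

/-- The blocks of `P` form a non-crossing collection. -/
def NonCrossingPairs {n : ℕ} (P : Finset (Finset (Fin n) × ℕ)) : Prop :=
  ¬ ∃ p ∈ P, ∃ q ∈ P, Prod.fst p ≠ Prod.fst q ∧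
      ∃ a b c d : Fin n, a ∈ Prod.fst p ∧ c ∈ Prod.fst p ∧
        b ∈ Prod.fst q ∧ d ∈ Prod.fst q ∧ Cyc4 a b c d

/-- `P` is a weighted non-crossing partition of `[n]` of weight `d`: a
non-crossing partition of `[n]` into nonempty blocks, each block `S` carrying
an integer weight `0 ≤ w ≤ |S|`, with total weight `d`. -/
def IsWNCP (n d : ℕ) (P : Finset (Finset (Fin n) × ℕ)) : Prop :=
  (∀ p ∈ P, (Prod.fst p).Nonempty ∧ Prod.snd p ≤ (Prod.fst p).card) ∧
  (∀ x : Fin n, ∃! p, p ∈ P ∧ x ∈ p.1) ∧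
  NonCrossingPairs P ∧
  (∑ p ∈ P, Prod.snd p) = d

/-- The cover relation of the poset of weighted partitions: `P` is obtained
from `Q` by merging two blocks, adding their weights. -/
def WNCPCover {n : ℕ} (Q P : Finset (Finset (Fin n) × ℕ)) : Prop :=
  ∃ (A B : Finset (Fin n)) (a b : ℕ), (A, a) ∈ Q ∧ (B, b) ∈ Q ∧ A ≠ B ∧
    P = insert (A ∪ B, a + b) ((Q.erase (A, a)).erase (B, b))

/-- The order of the poset `NC_n^d` of weighted non-crossing partitions of
`[n]` of weight `d`: the reflexive-transitive closure, within `NC_n^d`, of the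
merging cover relation. -/
def WNCPle (n d : ℕ) (Q P : Finset (Finset (Fin n) × ℕ)) : Prop :=
  IsWNCP n d Q ∧ IsWNCP n d P ∧
    Relation.ReflTransGen (fun X Y => IsWNCP n d X ∧ IsWNCP n d Y ∧ WNCPCover X Y) Q P

/-- The order on `NC_n^d ∪ {0̂}`, where `none = 0̂` is an added minimum. -/
def WNCPleBot (n d : ℕ) (a b : Option (Finset (Finset (Fin n) × ℕ))) : Prop :=
  a = none ∨ ∃ P Q, a = some P ∧ b = some Q ∧ WNCPle n d P Q


section Exchange

lemma wnc_mix_aux {E : Type*} [DecidableEq E] {ℬ : Finset E → Prop} (hB : IsBasesSet ℬ)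
    (φ : E → Prop) [DecidablePred φ]
    (hedge : ∀ B x y, ℬ B → x ∈ B → y ∉ B → ℬ (insert y (B.erase x)) → (φ x ↔ φ y)) :
    ∀ (k : ℕ) (B₁ B₂ : Finset E), ℬ B₁ → ℬ B₂ → ((B₁ \ B₂).filter (fun x => ¬ φ x)).card = k →
      ∃ B₃, ℬ B₃ ∧ (∀ x, φ x → (x ∈ B₃ ↔ x ∈ B₁)) ∧ (∀ x, ¬ φ x → x ∈ B₃ → x ∈ B₂) := by
  intro k
  induction k with
  | zero =>
    intro B₁ B₂ h1 h2 hk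
    refine ⟨B₁, h1, fun x _ => Iff.rfl, fun x hx hx1 => ?_⟩
    by_contra hx2
    rw [Finset.card_eq_zero] at hk
    have : x ∈ (B₁ \ B₂).filter (fun x => ¬ φ x) := by simp [hx, hx1, hx2]
    rw [hk] at this
    simp at this
  | succ k ih =>
    intro B₁ B₂ h1 h2 hk
    have hne : ((B₁ \ B₂).filter (fun x => ¬ φ x)).Nonempty := by
      rw [← Finset.card_pos]; omega
    obtain ⟨b₁, hb₁⟩ := hne
    simp only [Finset.mem_filter, Finset.mem_sdiff] at hb₁
    obtain ⟨⟨hb11, hb12⟩, hbφ⟩ := hb₁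
    obtain ⟨b₂, hb₂, hex⟩ := hB.2 h1 h2 b₁ (by simp [hb11, hb12])
    simp only [Finset.mem_sdiff] at hb₂
    have hφ2 := hedge B₁ b₁ b₂ h1 hb11 hb₂.2 hex
    obtain ⟨B₃, h3, h3a, h3b⟩ := ih (insert b₂ (B₁.erase b₁)) B₂ hex h2 (by
      have : ((insert b₂ (B₁.erase b₁) \ B₂).filter (fun x => ¬ φ x))
          = ((B₁ \ B₂).filter (fun x => ¬ φ x)).erase b₁ := by
        ext x
        simp only [Finset.mem_filter, Finset.mem_sdiff, Finset.mem_insert, Finset.mem_erase]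
        constructor
        · rintro ⟨⟨rfl | ⟨h, h'⟩, h''⟩, h3⟩
          · exact absurd hb₂.1 h''
          · exact ⟨h, ⟨h', h''⟩, h3⟩
        · rintro ⟨h, ⟨h', h''⟩, h3⟩
          exact ⟨⟨Or.inr ⟨h, h'⟩, h''⟩, h3⟩
      rw [this, Finset.card_erase_of_mem (by simp [hb11, hb12, hbφ]), hk]
      simp)
    refine ⟨B₃, h3, fun x hx => ?_, h3b⟩
    rw [h3a x hx, Finset.mem_insert, Finset.mem_erase]
    have e1 : x ≠ b₁ := by rintro rfl; exact hbφ hx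
    have e2 : x ≠ b₂ := by rintro rfl; exact hbφ (hφ2.2 hx)
    simp [e1, e2]

lemma wnc_mix {E : Type*} [DecidableEq E] {ℬ : Finset E → Prop} (hB : IsBasesSet ℬ)
    (r : ℕ) (hr : ∀ B, ℬ B → B.card = r)
    (φ : E → Prop) [DecidablePred φ]
    (hedge : ∀ B x y, ℬ B → x ∈ B → y ∉ B → ℬ (insert y (B.erase x)) → (φ x ↔ φ y))
    (B₁ B₂ : Finset E) (h1 : ℬ B₁) (h2 : ℬ B₂) :
    ℬ (B₁.filter φ ∪ B₂.filter (fun x => ¬ φ x)) := by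
  obtain ⟨B₃, h3, h3a, h3b⟩ := wnc_mix_aux hB φ hedge _ B₁ B₂ h1 h2 rfl
  obtain ⟨B₅, h5, h5a, h5b⟩ := wnc_mix_aux hB (fun x => ¬ φ x)
    (fun B x y a b c d => not_congr (hedge B x y a b c d)) _ B₃ B₂ h3 h2 rfl
  have hsub : B₅ ⊆ B₂ := by
    intro x hx
    by_cases hφ : φ x
    · exact h5b x (by simpa using hφ) hx
    · exact h3b x hφ ((h5a x hφ).1 hx)
  have heq : B₅ = B₂ := Finset.eq_of_subset_of_card_le hsub (by rw [hr _ h5, hr _ h2])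
  subst heq
  have : B₁.filter φ ∪ B₅.filter (fun x => ¬ φ x) = B₃ := by
    ext x
    simp only [Finset.mem_union, Finset.mem_filter]
    by_cases hφ : φ x
    · simp [hφ, h3a x hφ]
    · simp [hφ, h5a x hφ]
  rw [this]
  exact h3

lemma wnc_part_bases {E : Type*} [DecidableEq E] {ℬ : Finset E → Prop} (hB : IsBasesSet ℬ)
    (φ : E → Prop) [DecidablePred φ]
    (hedge : ∀ B x y, ℬ B → x ∈ B → y ∉ B → ℬ (insert y (B.erase x)) → (φ x ↔ φ y)) :
    IsBasesSet (fun C => ∃ B, ℬ B ∧ C = B.filter φ) := by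
  refine ⟨?_, ?_⟩
  · obtain ⟨B, hb⟩ := hB.1
    exact ⟨_, B, hb, rfl⟩
  · rintro _ _ ⟨B₁, h1, rfl⟩ ⟨B₂, h2, rfl⟩ b₁ hb₁
    simp only [Finset.mem_sdiff, Finset.mem_filter, not_and] at hb₁
    obtain ⟨⟨hb11, hbφ⟩, hb12⟩ := hb₁
    have hb2 : b₁ ∉ B₂ := fun h => hb12 h hbφ
    obtain ⟨b₂, hb₂, hex⟩ := hB.2 h1 h2 b₁ (by simp [hb11, hb2])
    simp only [Finset.mem_sdiff] at hb₂
    have hφ2 := hedge B₁ b₁ b₂ h1 hb11 hb₂.2 hex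
    refine ⟨b₂, by simp [hb₂, hφ2.1 hbφ], _, hex, ?_⟩
    ext x
    simp only [Finset.mem_filter, Finset.mem_insert, Finset.mem_erase]
    constructor
    · rintro (rfl | ⟨h, h', h''⟩)
      · exact ⟨Or.inl rfl, hφ2.1 hbφ⟩
      · exact ⟨Or.inr ⟨h, h'⟩, h''⟩
    · rintro ⟨rfl | h, h'⟩
      · exact Or.inl rfl
      · exact Or.inr ⟨h.1, h.2, h'⟩

lemma wnc_connected_edge {E : Type*} [Fintype E] [DecidableEq E] {ℬ : Finset E → Prop}
    (hB : IsBasesSet ℬ) (r : ℕ) (hr : ∀ B, ℬ B → B.card = r) (hc : MatroidConnected ℬ)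
    (φ : E → Prop) (h1 : ∃ x, φ x) (h2 : ∃ x, ¬ φ x) :
    ∃ B x y, ℬ B ∧ x ∈ B ∧ y ∉ B ∧ ℬ (insert y (B.erase x)) ∧ ¬ (φ x ↔ φ y) := by
  classical
  by_contra hcon
  have hedge : ∀ B x y, ℬ B → x ∈ B → y ∉ B → ℬ (insert y (B.erase x)) → (φ x ↔ φ y) := by
    intro B x y a b c d
    by_contra h
    exact hcon ⟨B, x, y, a, b, c, d, h⟩
  apply hc
  refine ⟨univ.filter φ, univ.filter (fun x => ¬ φ x), fun C => ∃ B, ℬ B ∧ C = B.filter φ,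
    fun C => ∃ B, ℬ B ∧ C = B.filter (fun x => ¬ φ x), ?_, ?_, ?_, ?_, ?_, ?_, ?_, ?_, ?_⟩
  · obtain ⟨x, hx⟩ := h1
    exact ⟨x, by simp [hx]⟩
  · obtain ⟨x, hx⟩ := h2
    exact ⟨x, by simp [hx]⟩
  · exact Finset.disjoint_filter_filter_not _ _ _
  · exact Finset.filter_union_filter_not_eq _ _
  · exact wnc_part_bases hB φ hedge
  · exact wnc_part_bases hB (fun x => ¬ φ x)
      (fun B x y a b c d => not_congr (hedge B x y a b c d))
  · rintro _ ⟨B, _, rfl⟩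
    exact Finset.filter_subset_filter _ (Finset.subset_univ _)
  · rintro _ ⟨B, _, rfl⟩
    exact Finset.filter_subset_filter _ (Finset.subset_univ _)
  · intro B
    constructor
    · intro hb
      exact ⟨_, _, ⟨B, hb, rfl⟩, ⟨B, hb, rfl⟩, (Finset.filter_union_filter_not_eq _ _).symm⟩
    · rintro ⟨_, _, ⟨B₁, h1, rfl⟩, ⟨B₂, h2, rfl⟩, rfl⟩
      exact wnc_mix hB r hr φ hedge B₁ B₂ h1 h2

/-- Two distinct members of `P` sharing a point coincide. -/
lemma wnc_block_unique {n : ℕ} {P : Finset (Finset (Fin n) × ℕ)}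
    (hP : ∀ x : Fin n, ∃! p, p ∈ P ∧ x ∈ p.1) {p q : Finset (Fin n) × ℕ} (hp : p ∈ P)
    (hq : q ∈ P) {x : Fin n} (hxp : x ∈ p.1) (hxq : x ∈ q.1) : p = q :=
  (hP x).unique ⟨hp, hxp⟩ ⟨hq, hxq⟩

/-- In a connected component, an exchange crosses every nontrivial cut. -/
lemma wnc_edge {n : ℕ} {ℬ : Finset (Fin n) → Prop} {P : Finset (Finset (Fin n) × ℕ)}
    (hB : IsBasesSet ℬ) (hP : IsWeightedCompPartition ℬ P) {p : Finset (Fin n) × ℕ} (hp : p ∈ P)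
    (φ : Fin n → Prop) (h1 : ∃ x ∈ p.1, φ x) (h2 : ∃ x ∈ p.1, ¬ φ x) :
    ∃ B x y, ℬ B ∧ x ∈ p.1 ∧ y ∈ p.1 ∧ x ∈ B ∧ y ∉ B ∧ ℬ (insert y (B.erase x)) ∧ φ x ∧ ¬ φ y := by
  obtain ⟨hpart, hne, hdir, hconn, hrk⟩ := hP
  -- mixing along the block
  have hmix : ∀ B₁ B₂, ℬ B₁ → ℬ B₂ → ℬ ((B₂ ∩ p.1) ∪ (B₁ \ p.1)) := by
    intro B₁ B₂ hb1 hb2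
    rw [hdir]
    intro q hq
    by_cases hqp : q = p
    · subst hqp
      refine ⟨B₂, hb2, ?_⟩
      ext x; simp only [Finset.mem_inter, Finset.mem_union, Finset.mem_sdiff]; tauto
    · refine ⟨B₁, hb1, ?_⟩
      ext x
      have : x ∈ q.1 → x ∉ p.1 := fun h h' => hqp (wnc_block_unique hpart hq hp h h')
      simp only [Finset.mem_inter, Finset.mem_union, Finset.mem_sdiff]; tauto
  set em := Function.Embedding.subtype fun x => x ∈ p.1 with hem
  have hmem : ∀ (C : Finset {x // x ∈ p.1}) (x : Fin n) (hx : x ∈ p.1),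
      x ∈ C.map em ↔ (⟨x, hx⟩ : {x // x ∈ p.1}) ∈ C := by
    intro C x hx
    simp [hem, hx]
  have hmem' : ∀ (C : Finset {x // x ∈ p.1}) (B : Finset (Fin n)), C.map em = B ∩ p.1 →
      ∀ x : {x // x ∈ p.1}, x ∈ C ↔ x.1 ∈ B := by
    intro C B h x
    rw [← hmem C x.1 x.2, h]; simp [x.2]
  have hmk : ∀ (C : Finset {x // x ∈ p.1}) (B : Finset (Fin n)),
      (∀ x : {x // x ∈ p.1}, x ∈ C ↔ x.1 ∈ B) → C.map em = B ∩ p.1 := by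
    intro C B h
    ext x
    by_cases hx : x ∈ p.1
    · rw [hmem C x hx, h]; simp [hx]
    · simp [hx, hem]
  have hext : ∀ u v : {x // x ∈ p.1}, u = v ↔ u.1 = v.1 := fun u v => Subtype.ext_iff
  have hbb : IsBasesSet (blockBases ℬ p.1) := by
    refine ⟨?_, ?_⟩
    · obtain ⟨B, hb⟩ := hB.1
      exact ⟨univ.filter (fun x => x.1 ∈ B), B, hb, hmk _ _ (by simp)⟩
    · rintro C₁ C₂ ⟨B₁, hb1, hC1⟩ ⟨B₂, hb2, hC2⟩ c hc
      have hc1 := hmem' _ _ hC1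
      have hc2 := hmem' _ _ hC2
      simp only [Finset.mem_sdiff, hc1, hc2] at hc
      obtain ⟨b, hb, hex⟩ := hB.2 hb1 (hmix B₁ B₂ hb1 hb2) c.1 (by simp [hc, c.2])
      simp only [Finset.mem_sdiff, Finset.mem_union, Finset.mem_inter] at hb
      have hbp : b ∈ p.1 := by tauto
      refine ⟨⟨b, hbp⟩, by simp only [Finset.mem_sdiff, hc1, hc2]; tauto, _, hex, hmk _ _ ?_⟩
      intro x
      simp only [Finset.mem_insert, Finset.mem_erase, hc1, ne_eq, hext]
  obtain ⟨C, x, y, ⟨B, hBb, hCB⟩, hx, hy, ⟨B', hB', hCB'⟩, hne⟩ :=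
    wnc_connected_edge hbb p.2 (by
      rintro C ⟨B, hb, hC⟩
      rw [← hrk p hp B hb, ← hC, Finset.card_map]) (hconn p hp) (fun x => φ x.1)
      (by obtain ⟨x, hx, h⟩ := h1; exact ⟨⟨x, hx⟩, h⟩)
      (by obtain ⟨x, hx, h⟩ := h2; exact ⟨⟨x, hx⟩, h⟩)
  have hxB := (hmem' _ _ hCB x).1 hx
  have hyB := fun h => hy ((hmem' _ _ hCB y).2 h)
  have hex : ℬ (insert y.1 (B.erase x.1)) := by
    convert hmix B B' hBb hB' using 1
    rw [← hCB']
    ext z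
    by_cases hz : z ∈ p.1
    · rw [Finset.mem_union, hmem _ _ hz]
      simp only [Finset.mem_insert, Finset.mem_erase, hmem' _ _ hCB, ne_eq, hext,
        Finset.mem_sdiff, hz, not_true_eq_false, and_false, or_false]
    · have e1 : z ≠ y.1 := by rintro rfl; exact hz y.2
      have e2 : z ≠ x.1 := by rintro rfl; exact hz x.2
      simp [hz, e1, e2]
  by_cases hφ : φ x.1
  · exact ⟨B, x, y, hBb, x.2, y.2, hxB, hyB, hex, hφ, by tauto⟩
  · have hxy : x.1 ≠ y.1 := fun h => hyB (h ▸ hxB)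
    refine ⟨_, y, x, hex, y.2, x.2, by simp, by simp [hxy], ?_, by tauto, hφ⟩
    convert hBb using 1
    ext z
    simp only [Finset.mem_insert, Finset.mem_erase]
    constructor
    · rintro (rfl | ⟨h, h' | h'⟩)
      · exact hxB
      · exact absurd h' h
      · exact h'.2
    · intro hz
      by_cases hzx : z = x.1
      · exact Or.inl hzx
      · refine Or.inr ⟨?_, Or.inr ⟨hzx, hz⟩⟩
        rintro rfl; exact hyB hz

/-- A functional constant on bases is constant on components. -/
lemma wnc_const {n : ℕ} {ℬ : Finset (Fin n) → Prop} {P : Finset (Finset (Fin n) × ℕ)}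
    (hB : IsBasesSet ℬ) (hP : IsWeightedCompPartition ℬ P) {p : Finset (Fin n) × ℕ} (hp : p ∈ P)
    (w : Fin n → ℝ) (m : ℝ) (hw : ∀ B, ℬ B → ∑ i ∈ B, w i = m) {x y : Fin n} (hx : x ∈ p.1)
    (hy : y ∈ p.1) : w x = w y := by
  by_contra hne
  obtain ⟨B, a, b, hBb, -, -, haB, hbB, hex, ha, hb⟩ := wnc_edge hB hP hp (fun z => w z = w x)
    ⟨x, hx, rfl⟩ ⟨y, hy, fun h => hne h.symm⟩
  have e1 := hw _ hex
  rw [Finset.sum_insert (by simp [hbB])] at e1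
  have e2 := hw _ hBb
  rw [← Finset.add_sum_erase _ _ haB] at e2
  apply hb
  rw [← ha]; linarith

end Exchange

section Matrices

open Matrix Function

variable {d n : ℕ}

lemma wnc_det_ne_iff {A : Matrix (Fin d) (Fin n) ℝ} {ℬ : Finset (Fin n) → Prop}
    (hA : A.RepresentsBases ℬ) (f : Fin d → Fin n) (hf : Injective f) :
    (A.submatrix id f).det ≠ 0 ↔ ℬ (univ.image f) := by
  have hcard : (univ.image f).card = d := by
    rw [Finset.card_image_of_injective _ hf]; simp
  rw [hA, ← isUnit_iff_ne_zero, ← Matrix.isUnit_iff_isUnit_det,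
    ← Matrix.linearIndependent_cols_iff_isUnit]
  simp only [hcard, true_and]
  have hbij : Bijective (fun k : Fin d => (⟨f k, by simp⟩ : {x // x ∈ univ.image f})) := by
    constructor
    · intro a b hab
      exact hf (by simpa using hab)
    · rintro ⟨x, hx⟩
      obtain ⟨k, -, rfl⟩ := Finset.mem_image.1 hx
      exact ⟨k, rfl⟩
  rw [← linearIndependent_equiv (Equiv.ofBijective _ hbij)]
  rfl

lemma wnc_det_inj {A : Matrix (Fin d) (Fin n) ℝ} {f : Fin d → Fin n}
    (h : (A.submatrix id f).det ≠ 0) : Injective f := by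
  intro i j hij
  by_contra hne
  apply h
  exact Matrix.det_zero_of_column_eq hne (fun k => by simp [hij])

/-- Enumerate a set of size `d`. -/
lemma wnc_enum (B : Finset (Fin n)) (hB : B.card = d) :
    ∃ f : Fin d → Fin n, StrictMono f ∧ univ.image f = B := by
  refine ⟨B.orderEmbOfFin hB, (B.orderEmbOfFin hB).strictMono, ?_⟩
  ext x
  have := Finset.range_orderEmbOfFin B hB
  have h2 : x ∈ Set.range (B.orderEmbOfFin hB) ↔ x ∈ (B : Set (Fin n)) := by rw [this]
  simp at h2 ⊢

lemma wnc_submatrix_update (A : Matrix (Fin d) (Fin n) ℝ) (f : Fin d → Fin n) (i : Fin d)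
    (v : Fin n) :
    A.submatrix id (update f i v) = (A.submatrix id f).updateCol i (fun r => A r v) := by
  ext r c
  by_cases h : c = i
  · subst h; simp
  · simp [h]

lemma wnc_image_update (f : Fin d → Fin n) (hf : Injective f) (i : Fin d) (v : Fin n) :
    univ.image (update f i v) = insert v ((univ.image f).erase (f i)) := by
  ext x
  simp only [Finset.mem_image, Finset.mem_univ, true_and, Finset.mem_insert, Finset.mem_erase]
  constructor
  · rintro ⟨k, rfl⟩
    by_cases hk : k = i
    · subst hk; simp
    · right; rw [update_of_ne hk]; exact ⟨fun h => hk (hf h), k, rfl⟩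
  · rintro (rfl | ⟨h, k, rfl⟩)
    · exact ⟨i, by simp⟩
    · refine ⟨k, update_of_ne ?_ _ _⟩
      rintro rfl; exact h rfl

lemma wnc_update_inj (f : Fin d → Fin n) (hf : Injective f) (i : Fin d) (v : Fin n)
    (hv : v ∉ (univ.image f).erase (f i)) : Injective (update f i v) := by
  have key : ∀ k, k ≠ i → f k ≠ v := by
    intro k hk h
    apply hv
    rw [Finset.mem_erase]
    refine ⟨?_, by simp [← h]⟩
    rw [← h]; exact fun h' => hk (hf h')
  intro a b hab
  by_cases ha : a = i <;> by_cases hb : b = i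
  · rw [ha, hb]
  · subst ha; rw [update_self, update_of_ne hb] at hab; exact absurd hab.symm (key b hb)
  · subst hb; rw [update_self, update_of_ne ha] at hab; exact absurd hab (key a ha)
  · rw [update_of_ne ha, update_of_ne hb] at hab; exact hf hab

/-- Cramer's rule. -/
lemma wnc_cramer (A : Matrix (Fin d) (Fin n) ℝ) (f : Fin d → Fin n) (v : Fin n) (r : Fin d) :
    ∑ q, A r (f q) * (A.submatrix id (update f q v)).det = (A.submatrix id f).det * A r v := by
  have := congrFun (Matrix.mulVec_cramer (A.submatrix id f) (fun r => A r v)) r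
  simp only [Matrix.mulVec, dotProduct, Matrix.cramer_apply, Matrix.submatrix_apply, id,
    Pi.smul_apply, smul_eq_mul] at this
  simpa only [wnc_submatrix_update] using this

lemma wnc_plucker (A : Matrix (Fin d) (Fin n) ℝ) (f : Fin d → Fin n) (i k : Fin d) (hik : i ≠ k)
    (y v : Fin n) (h0 : (A.submatrix id (update f i v)).det = 0) :
    (A.submatrix id f).det * (A.submatrix id (update (update f i y) k v)).det
      = (A.submatrix id (update f k v)).det * (A.submatrix id (update f i y)).det := by
  have h1 := Matrix.det_updateCol_sum (A.submatrix id (update f i y)) k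
    (fun q => (A.submatrix id (update f q v)).det)
  simp only [smul_eq_mul] at h1
  rw [← h1, wnc_submatrix_update A (update f i y) k v, ← Matrix.det_updateCol_smul]
  congr 2
  ext r
  rw [Pi.smul_apply, smul_eq_mul, ← wnc_cramer]
  refine Finset.sum_congr rfl fun q _ => ?_
  by_cases hq : q = i
  · subst hq; simp [h0]
  · simp [update_of_ne hq, mul_comm]

/-- The exchange property for a representable matroid. -/
lemma wnc_isBases {A : Matrix (Fin d) (Fin n) ℝ} {ℬ : Finset (Fin n) → Prop}
    (hA : A.RepresentsBases ℬ) (hne : ∃ B, ℬ B) : IsBasesSet ℬ := by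
  refine ⟨hne, ?_⟩
  intro B₁ B₂ h1 h2 b₁ hb
  rw [Finset.mem_sdiff] at hb
  obtain ⟨f, hf, rfl⟩ := wnc_enum B₁ ((hA _).1 h1).1
  obtain ⟨g, hg, rfl⟩ := wnc_enum B₂ ((hA _).1 h2).1
  have hf0 := (wnc_det_ne_iff hA f hf.injective).2 h1
  have hg0 := (wnc_det_ne_iff hA g hg.injective).2 h2
  obtain ⟨i, -, rfl⟩ := Finset.mem_image.1 hb.1
  -- some element of the second basis has nonzero coordinate at `i`
  have hex : ∃ k, (A.submatrix id (update f i (g k))).det ≠ 0 := by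
    by_contra hcon
    push Not at hcon
    have hmul : (A.submatrix id f)⁻¹ * (A.submatrix id g) * (A.submatrix id g)⁻¹
        = (A.submatrix id f)⁻¹ := by
      rw [Matrix.mul_assoc, Matrix.mul_nonsing_inv _ (isUnit_iff_ne_zero.2 hg0), Matrix.mul_one]
    have hrow : ∀ k, ((A.submatrix id f)⁻¹ * (A.submatrix id g)) i k = 0 := by
      intro k
      have hc : ∀ r, ∑ q, A r (f q) * (A.submatrix id (update f q (g k))).det
        = (A.submatrix id f).det * A r (g k) := fun r => wnc_cramer A f (g k) r
      have hc2 : (A.submatrix id f) *ᵥ (fun q => (A.submatrix id (update f q (g k))).det)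
        = (A.submatrix id f).det • (fun r => A r (g k)) := by
        ext r
        simpa [Matrix.mulVec, dotProduct] using hc r
      have hc3 := congrArg (fun z => (A.submatrix id f)⁻¹ *ᵥ z) hc2
      simp only [Matrix.mulVec_mulVec, Matrix.nonsing_inv_mul _ (isUnit_iff_ne_zero.2 hf0),
        Matrix.one_mulVec, Matrix.mulVec_smul] at hc3
      have hc4 := congrFun hc3 i
      simp only [hcon k, Pi.smul_apply, smul_eq_mul] at hc4
      have : ((A.submatrix id f)⁻¹ *ᵥ fun r => A r (g k)) i = 0 := by
        rcases mul_eq_zero.1 hc4.symm with h | h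
        · exact absurd h hf0
        · exact h
      simpa [Matrix.mulVec, dotProduct, Matrix.mul_apply] using this
    have hrow2 : ∀ c, (A.submatrix id f)⁻¹ i c = 0 := by
      intro c
      rw [← hmul, Matrix.mul_apply]
      simp [hrow]
    have := congrFun (congrFun (Matrix.nonsing_inv_mul _ (isUnit_iff_ne_zero.2 hf0)) i) i
    rw [Matrix.mul_apply] at this
    simp [hrow2] at this
  obtain ⟨k, hk⟩ := hex
  have hinj := wnc_det_inj hk
  refine ⟨g k, ?_, ?_⟩
  · rw [Finset.mem_sdiff]
    refine ⟨by simp, fun hmem => ?_⟩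
    obtain ⟨j, -, hj⟩ := Finset.mem_image.1 hmem
    by_cases hji : j = i
    · subst hji; exact hb.2 (by rw [hj]; simp)
    · apply hji
      apply hinj
      rw [update_of_ne hji, update_self, hj]
  · rw [← wnc_image_update f hf.injective]
    exact (wnc_det_ne_iff hA _ hinj).1 hk

/-- The Vandermonde product, used to record the sign of a sorting permutation. -/
def wncV (f : Fin d → Fin n) : ℝ := ∏ i : Fin d, ∏ j ∈ Finset.Ioi i, ((f j : ℝ) - (f i : ℝ))

lemma wncV_perm (f : Fin d → Fin n) (σ : Equiv.Perm (Fin d)) :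
    wncV (f ∘ σ) = (Equiv.Perm.sign σ : ℝ) * wncV f := by
  have h1 : wncV f = ((Matrix.vandermonde (fun i => ((f i : Fin n) : ℝ)))ᵀ).det := by
    rw [Matrix.det_transpose, Matrix.det_vandermonde]; rfl
  have h2 : wncV (f ∘ σ)
      = ((Matrix.vandermonde (fun i => ((f i : Fin n) : ℝ)))ᵀ.submatrix id σ).det := by
    rw [← Matrix.transpose_submatrix, Matrix.det_transpose]
    have := Matrix.det_vandermonde (fun i => ((f (σ i) : Fin n) : ℝ))
    unfold wncV
    simp only [Function.comp_apply]
    rw [← this]; rfl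
  rw [h1, h2, Matrix.det_permute']

lemma wncV_mono (f : Fin d → Fin n) (hf : StrictMono f) : 0 < wncV f := by
  unfold wncV
  refine Finset.prod_pos fun i _ => Finset.prod_pos fun j hj => ?_
  have : f i < f j := hf (Finset.mem_Ioi.1 hj)
  have : ((f i : ℕ) : ℝ) < ((f j : ℕ) : ℝ) := by exact_mod_cast this
  linarith

lemma wnc_sign_det {A : Matrix (Fin d) (Fin n) ℝ} (hA : A.TotallyNonneg) (f : Fin d → Fin n) :
    0 ≤ (A.submatrix id f).det * wncV f := by
  by_cases hd : (A.submatrix id f).det = 0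
  · simp [hd]
  have hf := wnc_det_inj hd
  have hs : StrictMono (f ∘ Tuple.sort f) :=
    (Tuple.monotone_sort f).strictMono_of_injective (hf.comp (Equiv.injective _))
  have h1 := hA.2 _ hs
  have h2 := wncV_mono _ hs
  have h3 : (A.submatrix id (f ∘ Tuple.sort f)).det
      = (Equiv.Perm.sign (Tuple.sort f) : ℝ) * (A.submatrix id f).det := by
    rw [← Matrix.det_permute']; rfl
  rw [wncV_perm] at h2
  rw [h3] at h1
  have h4 := mul_nonneg h1 h2.le
  have h5 : ((Equiv.Perm.sign (Tuple.sort f) : ℤ) : ℝ) * ((Equiv.Perm.sign (Tuple.sort f) : ℤ) : ℝ)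
      = 1 := by
    norm_cast
    rcases Int.units_eq_one_or (Equiv.Perm.sign (Tuple.sort f)) with h | h <;> simp [h]
  calc (0:ℝ) ≤ _ := h4
    _ = (((Equiv.Perm.sign (Tuple.sort f) : ℤ) : ℝ) * ((Equiv.Perm.sign (Tuple.sort f) : ℤ) : ℝ))
      * ((A.submatrix id f).det * wncV f) := by ring
    _ = _ := by rw [h5, one_mul]

lemma wncV_four (f : Fin d → Fin n) (i k : Fin d) (hik : i ≠ k) (y v : Fin n)
    (h0 : Injective f) (h1 : Injective (update f i y)) (h2 : Injective (update f k v))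
    (h12 : Injective (update (update f i y) k v))
    (hcross : ((f i : ℝ) - f k) * ((y : ℝ) - f k) * ((f i : ℝ) - v) * ((y : ℝ) - v) < 0) :
    wncV f * wncV (update (update f i y) k v) * (wncV (update f k v) * wncV (update f i y)) < 0 := by
  unfold wncV
  simp only [← Finset.prod_mul_distrib]
  rw [Finset.prod_sigma' univ (fun i : Fin d => Finset.Ioi i)
    (fun p q => _ : Fin d → Fin d → ℝ)]
  have hpos : ∀ (x : Σ _ : Fin d, Fin d), x ∈ (univ.sigma fun i : Fin d => Finset.Ioi i) →
      ¬ (x.1 = i ∧ x.2 = k) → ¬ (x.1 = k ∧ x.2 = i) →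
      0 < ((f x.2 : ℝ) - f x.1)
        * ((update (update f i y) k v x.2 : ℝ) - update (update f i y) k v x.1)
        * (((update f k v x.2 : ℝ) - update f k v x.1)
          * ((update f i y x.2 : ℝ) - update f i y x.1)) := by
    rintro ⟨p, q⟩ hpq hn1 hn2
    simp only [Finset.mem_sigma, Finset.mem_univ, true_and, Finset.mem_Ioi] at hpq
    simp only at hn1 hn2 ⊢
    have hne : q ≠ p := hpq.ne'
    have ne : ∀ g : Fin d → Fin n, Injective g → ((g q : ℝ) - g p) ≠ 0 := by
      intro g hg h
      apply hne
      apply hg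
      have : ((g q : ℕ) : ℝ) = ((g p : ℕ) : ℝ) := by linarith
      exact Fin.ext (by exact_mod_cast this)
    have n0 := ne _ h0
    have n1 := ne _ h1
    have n2 := ne _ h2
    have n12 := ne _ h12
    have sq : ∀ a b : ℝ, a ≠ 0 → b ≠ 0 → 0 < a * b * (a * b) := fun a b ha hb =>
      mul_self_pos.2 (mul_ne_zero ha hb)
    by_cases hpi : p = i
    · have hqk : q ≠ k := fun h => hn1 ⟨hpi, h⟩
      have hqi : q ≠ i := hpi ▸ hne
      have hpk : p ≠ k := hpi ▸ hik
      have e2 : ((update f k v q : ℝ) - update f k v p) = ((f q : ℝ) - f p) := by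
        rw [update_of_ne hqk, update_of_ne hpk]
      have e12 : ((update (update f i y) k v q : ℝ) - update (update f i y) k v p)
          = ((update f i y q : ℝ) - update f i y p) := by
        rw [update_of_ne hqk, update_of_ne hpk]
      rw [e2, e12]; exact sq _ _ n0 n1
    by_cases hqi : q = i
    · have hpk : p ≠ k := fun h => hn2 ⟨h, hqi⟩
      have hqk : q ≠ k := hqi ▸ hik
      have e2 : ((update f k v q : ℝ) - update f k v p) = ((f q : ℝ) - f p) := by
        rw [update_of_ne hqk, update_of_ne hpk]
      have e12 : ((update (update f i y) k v q : ℝ) - update (update f i y) k v p)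
          = ((update f i y q : ℝ) - update f i y p) := by
        rw [update_of_ne hqk, update_of_ne hpk]
      rw [e2, e12]; exact sq _ _ n0 n1
    · have e2 : ((update f i y q : ℝ) - update f i y p) = ((f q : ℝ) - f p) := by
        rw [update_of_ne hqi, update_of_ne hpi]
      have e12 : ((update (update f i y) k v q : ℝ) - update (update f i y) k v p)
          = ((update f k v q : ℝ) - update f k v p) := by
        rw [update_comm hik, update_of_ne hqi, update_of_ne hpi]
      rw [e2, e12]
      have := sq _ _ n2 n0
      linarith
  rcases lt_or_gt_of_ne hik with hlt | hlt
  · rw [← Finset.mul_prod_erase _ _ (show (⟨i, k⟩ : Σ _ : Fin d, Fin d) ∈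
      (univ.sigma fun i : Fin d => Finset.Ioi i) by simp [hlt])]
    apply mul_neg_of_neg_of_pos
    · simp only [update_self, update_of_ne hik]
      rw [update_of_ne hik.symm]
      nlinarith [hcross]
    · refine Finset.prod_pos fun x hx => ?_
      rw [Finset.mem_erase] at hx
      refine hpos x hx.2 ?_ ?_
      · rintro ⟨a, b⟩; apply hx.1; obtain ⟨p, q⟩ := x; simp_all
      · rintro ⟨a, b⟩
        have := hx.2
        simp only [Finset.mem_sigma, Finset.mem_univ, true_and, Finset.mem_Ioi, a, b] at this
        exact absurd this hlt.not_gt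
  · rw [← Finset.mul_prod_erase _ _ (show (⟨k, i⟩ : Σ _ : Fin d, Fin d) ∈
      (univ.sigma fun i : Fin d => Finset.Ioi i) by simp [hlt])]
    apply mul_neg_of_neg_of_pos
    · simp only [update_self, update_of_ne hik]
      rw [update_of_ne hik.symm]
      nlinarith [hcross]
    · refine Finset.prod_pos fun x hx => ?_
      rw [Finset.mem_erase] at hx
      refine hpos x hx.2 ?_ ?_
      · rintro ⟨a, b⟩
        have := hx.2
        simp only [Finset.mem_sigma, Finset.mem_univ, true_and, Finset.mem_Ioi, a, b] at this
        exact absurd this hlt.not_gt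
      · rintro ⟨a, b⟩; apply hx.1; obtain ⟨p, q⟩ := x; simp_all

/-- The key positivity contradiction. -/
lemma wnc_no_cross {A : Matrix (Fin d) (Fin n) ℝ} (hA : A.TotallyNonneg) (f : Fin d → Fin n)
    (i k : Fin d) (hik : i ≠ k) (y v : Fin n)
    (h0 : (A.submatrix id f).det ≠ 0) (h1 : (A.submatrix id (update f i y)).det ≠ 0)
    (h2 : (A.submatrix id (update f k v)).det ≠ 0)
    (hz : (A.submatrix id (update f i v)).det = 0) :
    ¬ ((f i : ℝ) - f k) * ((y : ℝ) - f k) * ((f i : ℝ) - v) * ((y : ℝ) - v) < 0 := by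
  intro hcross
  have hpl := wnc_plucker A f i k hik y v hz
  have h12 : (A.submatrix id (update (update f i y) k v)).det ≠ 0 := by
    intro h
    rw [h, mul_zero] at hpl
    exact mul_ne_zero h2 h1 hpl.symm
  have hV := wncV_four f i k hik y v (wnc_det_inj h0) (wnc_det_inj h1) (wnc_det_inj h2)
    (wnc_det_inj h12) hcross
  have hp := mul_nonneg (mul_nonneg (wnc_sign_det hA f)
    (wnc_sign_det hA (update (update f i y) k v)))
    (mul_nonneg (wnc_sign_det hA (update f k v)) (wnc_sign_det hA (update f i y)))
  set a := (A.submatrix id f).det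
  set b := (A.submatrix id (update (update f i y) k v)).det
  set c := (A.submatrix id (update f k v)).det
  set e := (A.submatrix id (update f i y)).det
  have hsq : 0 < (a * b) * (c * e) := by
    rw [hpl]; exact mul_self_pos.2 (mul_ne_zero h2 h1)
  have := mul_neg_of_pos_of_neg hsq hV
  nlinarith

end Matrices

section Faces

open Matrix Function

variable {d n : ℕ}

lemma wnc_block_mix {ℬ : Finset (Fin n) → Prop} {P : Finset (Finset (Fin n) × ℕ)}
    (hP : IsWeightedCompPartition ℬ P) {p : Finset (Fin n) × ℕ} (hp : p ∈ P)
    {B₁ B₂ : Finset (Fin n)} (hb1 : ℬ B₁) (hb2 : ℬ B₂) :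
    ℬ ((B₂ ∩ p.1) ∪ (B₁ \ p.1)) := by
  obtain ⟨hpart, hne, hdir, hconn, hrk⟩ := hP
  rw [hdir]
  intro q hq
  by_cases hqp : q = p
  · subst hqp
    refine ⟨B₂, hb2, ?_⟩
    ext x; simp only [Finset.mem_inter, Finset.mem_union, Finset.mem_sdiff]; tauto
  · refine ⟨B₁, hb1, ?_⟩
    ext x
    have : x ∈ q.1 → x ∉ p.1 := fun h h' => hqp (wnc_block_unique hpart hq hp h h')
    simp only [Finset.mem_inter, Finset.mem_union, Finset.mem_sdiff]; tauto

/-- `S` and `T` cross (with respect to the linear order). -/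
def wncCross (S T : Finset (Fin n)) : Prop :=
  ∃ s ∈ S, ∃ s' ∈ S, ∃ t ∈ T, ∃ t' ∈ T, t < s ∧ s < t' ∧ (s' < t ∨ t' < s')

set_option maxHeartbeats 1000000 in
lemma wnc_positroid_noncross {A : Matrix (Fin d) (Fin n) ℝ} {ℬ : Finset (Fin n) → Prop}
    (hA : A.TotallyNonneg) (hR : A.RepresentsBases ℬ) (hne : ∃ B, ℬ B)
    {P : Finset (Finset (Fin n) × ℕ)} (hP : IsWeightedCompPartition ℬ P)
    {p q : Finset (Fin n) × ℕ} (hp : p ∈ P) (hq : q ∈ P) (hpq : p ≠ q) :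
    ¬ wncCross p.1 q.1 := by
  rintro ⟨s, hs, s', hs', t, ht, t', ht', h1, h2, h3⟩
  have hB := wnc_isBases hR hne
  have hdisj : ∀ a b, a ∈ p.1 → b ∈ q.1 → a ≠ b := by
    rintro a b ha hb rfl
    exact hpq (wnc_block_unique hP.1 hp hq ha hb)
  obtain ⟨B, x, y, hBb, hx, hy, hxB, hyB, hex, hφx, hφy⟩ :=
    wnc_edge hB hP hp (fun z => t < z ∧ z < t') ⟨s, hs, h1, h2⟩ ⟨s', hs', by
      rintro ⟨a, b⟩; rcases h3 with h | h
      · exact absurd a h.not_gt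
      · exact absurd b h.not_gt⟩
  have hy' : y < t ∨ t' < y := by
    have e1 := hdisj y t hy ht
    have e2 := hdisj y t' hy ht'
    simp only [not_and, not_lt] at hφy
    rcases lt_or_gt_of_ne e1 with h | h
    · exact Or.inl h
    · exact Or.inr (lt_of_le_of_ne (hφy h) e2.symm)
  have cast : ∀ a b : Fin n, a < b → ((a : ℕ) : ℝ) < ((b : ℕ) : ℝ) := by
    intro a b h; exact_mod_cast h
  have hxt := cast _ _ hφx.1
  have hxt' := cast _ _ hφx.2
  have hbet : (∃ u ∈ q.1, ((x : ℝ) - u) * ((y : ℝ) - u) < 0) ∧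
      (∃ u ∈ q.1, ¬ ((x : ℝ) - u) * ((y : ℝ) - u) < 0) := by
    rcases hy' with h | h
    · have h' := cast _ _ h
      refine ⟨⟨t, ht, by nlinarith⟩, ⟨t', ht', by nlinarith⟩⟩
    · have h' := cast _ _ h
      refine ⟨⟨t', ht', by nlinarith⟩, ⟨t, ht, by nlinarith⟩⟩
  obtain ⟨B', u, v, hB'b, hu, hv, huB, hvB, hex', hφu, hφv⟩ :=
    wnc_edge hB hP hq (fun u => ((x : ℝ) - u) * ((y : ℝ) - u) < 0) hbet.1 hbet.2
  have castne : ∀ a b : Fin n, a ≠ b → ((a : ℕ) : ℝ) - ((b : ℕ) : ℝ) ≠ 0 := by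
    intro a b h h'
    apply h
    have : ((a : ℕ) : ℝ) = ((b : ℕ) : ℝ) := by linarith
    exact Fin.ext (by exact_mod_cast this)
  have hφv' : 0 < ((x : ℝ) - v) * ((y : ℝ) - v) := by
    refine lt_of_le_of_ne (not_lt.1 hφv) (Ne.symm (mul_ne_zero ?_ ?_))
    · exact castne _ _ (hdisj _ _ hx hv)
    · exact castne _ _ (hdisj _ _ hy hv)
  have hqn : ∀ a, a ∈ p.1 → a ∉ q.1 := fun a ha ha' => hdisj a a ha ha' rfl
  have hB0 := wnc_block_mix hP hq hBb hB'b
  have hB1 := wnc_block_mix hP hq hex hB'b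
  have hB2 := wnc_block_mix hP hq hBb hex'
  set B0 := (B' ∩ q.1) ∪ (B \ q.1) with hB0def
  have hxB0 : x ∈ B0 := by simp [hB0def, hxB, hqn x hx]
  have hyB0 : y ∉ B0 := by simp [hB0def, hyB, hqn y hy]
  have huB0 : u ∈ B0 := by simp [hB0def, huB, hu]
  have hvB0 : v ∉ B0 := by simp [hB0def, hvB, hv]
  have e1 : insert y (B0.erase x) = (B' ∩ q.1) ∪ (insert y (B.erase x) \ q.1) := by
    ext z
    have := hqn x hx
    have := hqn y hy
    by_cases hzx : z = x
    · subst hzx; simp [hB0def, hqn z hx]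
    by_cases hzy : z = y
    · subst hzy; simp [hqn z hy]
    simp [hB0def, hzx, hzy]
  have e2 : insert v (B0.erase u) = ((insert v (B'.erase u)) ∩ q.1) ∪ (B \ q.1) := by
    ext z
    by_cases hzx : z = u
    · subst hzx; simp [hB0def, hu]
    by_cases hzy : z = v
    · subst hzy; simp [hv]
    simp [hB0def, hzx, hzy]
  rw [← e1] at hB1
  rw [← e2] at hB2
  obtain ⟨f, hf, hfB⟩ := wnc_enum B0 ((hR _).1 hB0).1
  have hfi : ∃ i, f i = x := by
    rw [← hfB] at hxB0; simpa using hxB0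
  have hfk : ∃ k, f k = u := by
    rw [← hfB] at huB0; simpa using huB0
  obtain ⟨i, hi⟩ := hfi
  obtain ⟨k, hk⟩ := hfk
  have hik : i ≠ k := by
    rintro rfl
    exact hdisj x u hx hu (hi.symm.trans hk)
  have inj1 : Injective (update f i y) := wnc_update_inj f hf.injective i y (by
    rw [hfB, Finset.mem_erase]; exact fun h => hyB0 h.2)
  have inj2 : Injective (update f k v) := wnc_update_inj f hf.injective k v (by
    rw [hfB, Finset.mem_erase]; exact fun h => hvB0 h.2)
  refine wnc_no_cross hA f i k hik y v ?_ ?_ ?_ ?_ ?_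
  · rw [wnc_det_ne_iff hR f hf.injective, hfB]; exact hB0
  · rw [wnc_det_ne_iff hR _ inj1, wnc_image_update f hf.injective, hfB, hi]; exact hB1
  · rw [wnc_det_ne_iff hR _ inj2, wnc_image_update f hf.injective, hfB, hk]; exact hB2
  · by_contra hdet
    have := (wnc_det_ne_iff hR _ (wnc_det_inj hdet)).1 hdet
    rw [wnc_image_update f hf.injective, hfB, hi] at this
    have c1 := hP.2.2.2.2 p hp _ this
    have c2 := hP.2.2.2.2 p hp _ hB0
    have e3 : (insert v (B0.erase x)) ∩ p.1 = (B0 ∩ p.1).erase x := by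
      ext z
      have : z ∈ p.1 → z ≠ v := fun h => hdisj z v h hv
      simp only [Finset.mem_inter, Finset.mem_insert, Finset.mem_erase]
      constructor
      · rintro ⟨h | ⟨h, h'⟩, h''⟩
        · exact absurd h (this h'')
        · exact ⟨h, h', h''⟩
      · rintro ⟨h, h', h''⟩
        exact ⟨Or.inr ⟨h, h'⟩, h''⟩
    have hm : x ∈ B0 ∩ p.1 := by simp [hxB0, hx]
    rw [e3, Finset.card_erase_of_mem hm, c2] at c1
    have := Finset.card_pos.2 ⟨x, hm⟩
    omega
  · rw [hi, hk]
    have := mul_neg_of_neg_of_pos hφu hφv'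
    linarith

/-- The bases of minimal weight. -/
def wncMin (ℬ : Finset (Fin n) → Prop) (w : Fin n → ℝ) : Finset (Fin n) → Prop :=
  fun B => ℬ B ∧ ∀ B', ℬ B' → ∑ i ∈ B, w i ≤ ∑ i ∈ B', w i

lemma wncMin_exists {ℬ : Finset (Fin n) → Prop} (hne : ∃ B, ℬ B) (w : Fin n → ℝ) :
    ∃ B, wncMin ℬ w B := by
  obtain ⟨B, hB, hmin⟩ := Set.exists_min_image {B | ℬ B} (fun B => ∑ i ∈ B, w i)
    (Set.toFinite _) hne
  exact ⟨B, hB, hmin⟩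

/-- The initial matroid of a positroid is a positroid. -/
lemma wncMin_positroid {ℬ : Finset (Fin n) → Prop} (hpos : IsPositroidOfRank d ℬ)
    (hne : ∃ B, ℬ B) (w : Fin n → ℝ) : IsPositroidOfRank d (wncMin ℬ w) := by
  obtain ⟨A, hA, hR⟩ := hpos
  obtain ⟨B0, hB0, hmin⟩ := wncMin_exists hne w
  obtain ⟨f0, hf0, rfl⟩ := wnc_enum B0 ((hR _).1 hB0).1
  have hsum : ∀ f : Fin d → Fin n, Injective f → ∑ i ∈ univ.image f, w i = ∑ p, w (f p) :=
    fun f hf => Finset.sum_image (fun a _ b _ h => hf h)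
  have hD0 : (A.submatrix id f0).det ≠ 0 := (wnc_det_ne_iff hR f0 hf0.injective).2 hB0
  have hD0pos : 0 < (A.submatrix id f0).det := lt_of_le_of_ne (hA.2 _ hf0) hD0.symm
  set D0 := (A.submatrix id f0).det with hD0def
  let A' : Matrix (Fin d) (Fin n) ℝ :=
    Matrix.of fun i j => (A.submatrix id (update f0 i j)).det / D0
  have hmul : ∀ f : Fin d → Fin n, A.submatrix id f = A.submatrix id f0 * A'.submatrix id f := by
    intro f
    ext r c
    rw [Matrix.mul_apply]
    have := wnc_cramer A f0 (f c) r
    simp only [Matrix.submatrix_apply, id, A', Matrix.of_apply]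
    rw [← mul_right_inj' hD0, ← this, Finset.mul_sum]
    refine Finset.sum_congr rfl fun q _ => ?_
    field_simp
  have hdet : ∀ f : Fin d → Fin n, (A.submatrix id f).det = D0 * (A'.submatrix id f).det := by
    intro f; rw [hmul f, Matrix.det_mul]
  have hle : ∀ i j, A' i j ≠ 0 → w (f0 i) ≤ w j := by
    intro i j hij
    have h1 : (A.submatrix id (update f0 i j)).det ≠ 0 := by
      intro h; apply hij; simp [A', h]
    have hinj := wnc_det_inj h1
    have h2 := hmin _ ((wnc_det_ne_iff hR _ hinj).1 h1)
    rw [hsum _ hf0.injective, hsum _ hinj, ← Finset.add_sum_erase _ _ (Finset.mem_univ i),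
      ← Finset.add_sum_erase _ (fun p => w (update f0 i j p)) (Finset.mem_univ i)] at h2
    have h3 : ∑ x ∈ univ.erase i, w (update f0 i j x) = ∑ x ∈ univ.erase i, w (f0 x) := by
      refine Finset.sum_congr rfl fun x hx => ?_
      rw [update_of_ne (Finset.ne_of_mem_erase hx)]
    rw [h3, update_self] at h2
    linarith
  let C : Matrix (Fin d) (Fin n) ℝ := Matrix.of fun i j => if w j = w (f0 i) then A' i j else 0
  have hC1 : ∀ f : Fin d → Fin n, ∑ p, w (f p) = ∑ p, w (f0 p) →
      (C.submatrix id f).det = (A'.submatrix id f).det := by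
    intro f hf
    rw [Matrix.det_apply, Matrix.det_apply]
    refine Finset.sum_congr rfl fun σ _ => ?_
    congr 1
    simp only [Matrix.submatrix_apply, id, C, Matrix.of_apply]
    by_cases hz : ∃ p, A' (σ p) (f p) = 0
    · obtain ⟨p, hp⟩ := hz
      rw [Finset.prod_eq_zero (Finset.mem_univ p), Finset.prod_eq_zero (Finset.mem_univ p) hp]
      simp [hp]
    · push Not at hz
      have hs : ∑ p, w (f0 (σ p)) = ∑ p, w (f p) := by
        rw [hf]; exact Equiv.sum_comp σ (fun p => w (f0 p))
      have := (Finset.sum_eq_sum_iff_of_le (fun p _ => hle _ _ (hz p))).1 hs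
      refine Finset.prod_congr rfl fun p hp => ?_
      rw [if_pos (this p hp).symm]
  have hC2 : ∀ f : Fin d → Fin n, ∑ p, w (f p) ≠ ∑ p, w (f0 p) →
      (C.submatrix id f).det = 0 := by
    intro f hf
    rw [Matrix.det_apply]
    refine Finset.sum_eq_zero fun σ _ => ?_
    have : ∃ p, w (f p) ≠ w (f0 (σ p)) := by
      by_contra hcon
      push Not at hcon
      apply hf
      rw [← Equiv.sum_comp σ (fun p => w (f0 p))]
      exact Finset.sum_congr rfl fun p _ => hcon p
    obtain ⟨p, hp⟩ := this
    rw [Finset.prod_eq_zero (Finset.mem_univ p), smul_zero]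
    simp [C, hp]
  have hA'f0 : (C.submatrix id f0).det ≠ 0 := by
    rw [hC1 f0 rfl]
    intro h
    have := hdet f0
    rw [h, mul_zero] at this
    exact hD0 this
  refine ⟨C, ⟨?_, ?_⟩, ?_⟩
  · apply le_antisymm
    · simpa using C.rank_le_height
    · have h1 : (C.submatrix id f0).rank = d := by
        have := Matrix.rank_of_isUnit (C.submatrix id f0)
          ((Matrix.isUnit_iff_isUnit_det _).2 (isUnit_iff_ne_zero.2 hA'f0))
        simpa using this
      refine h1.symm.le.trans ?_
      rw [← Matrix.rank_transpose (C.submatrix id f0), ← Matrix.rank_transpose C,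
        Matrix.transpose_submatrix]
      exact Matrix.rank_submatrix_le _ f0 (Equiv.refl _)
  · intro f hf
    by_cases h : ∑ p, w (f p) = ∑ p, w (f0 p)
    · rw [hC1 f h]
      have := hA.2 f hf
      rw [hdet f] at this
      exact nonneg_of_mul_nonneg_right this hD0pos
    · rw [hC2 f h]
  · have key : ∀ f : Fin d → Fin n, Injective f →
        (wncMin ℬ w (univ.image f) ↔ (C.submatrix id f).det ≠ 0) := by
      intro f hf
      constructor
      · rintro ⟨h1, h2⟩
        have e : ∑ p, w (f p) = ∑ p, w (f0 p) := by
          rw [← hsum f hf, ← hsum f0 hf0.injective]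
          exact le_antisymm (h2 _ hB0) (hmin _ h1)
        rw [hC1 f e]
        have := (wnc_det_ne_iff hR f hf).2 h1
        rw [hdet f] at this
        exact right_ne_zero_of_mul this
      · intro h
        have e : ∑ p, w (f p) = ∑ p, w (f0 p) := by
          by_contra hcon; exact h (hC2 f hcon)
        rw [hC1 f e] at h
        have h1 : ℬ (univ.image f) := by
          rw [← wnc_det_ne_iff hR f hf, hdet f]; exact mul_ne_zero hD0 h
        refine ⟨h1, fun B' hB' => ?_⟩
        rw [hsum f hf, e, ← hsum f0 hf0.injective]
        exact hmin _ hB'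
    intro B
    constructor
    · intro h
      obtain ⟨f, hf, rfl⟩ := wnc_enum B ((hR _).1 h.1).1
      exact (wnc_det_ne_iff (A := C) (ℬ := fun B => B.card = d ∧ LinearIndependent ℝ
        (fun j : B => fun i => C i j.1)) (fun _ => Iff.rfl) f hf.injective).1
          ((key f hf.injective).1 h)
    · intro h
      obtain ⟨f, hf, rfl⟩ := wnc_enum B h.1
      exact (key f hf.injective).2 ((wnc_det_ne_iff (A := C) (ℬ := fun B => B.card = d ∧
        LinearIndependent ℝ (fun j : B => fun i => C i j.1)) (fun _ => Iff.rfl) f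
          hf.injective).2 h)

/-- Indicator vector. -/
def wncInd (B : Finset (Fin n)) : Fin n → ℝ := fun i => if i ∈ B then (1 : ℝ) else 0

lemma wnc_ind_mem {ℬ : Finset (Fin n) → Prop} {B : Finset (Fin n)} (hB : ℬ B) :
    wncInd B ∈ matroidPolytope ℬ := subset_convexHull ℝ _ ⟨B, hB, rfl⟩

lemma wnc_ind_sum (B S : Finset (Fin n)) : ∑ i ∈ S, wncInd B i = ((B ∩ S).card : ℝ) := by
  unfold wncInd
  rw [Finset.sum_ite_mem]
  simp [Finset.inter_comm]

lemma wnc_lin (w : (Fin n → ℝ) →ₗ[ℝ] ℝ) (x : Fin n → ℝ) :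
    w x = ∑ i, x i * w (Pi.single i 1) := by
  have := LinearMap.pi_apply_eq_sum_univ w x
  rw [this]
  refine Finset.sum_congr rfl fun i _ => ?_
  rw [smul_eq_mul]
  congr 2
  ext j
  simp [Pi.single_apply, eq_comm]

lemma wnc_lin_ind (w : (Fin n → ℝ) →ₗ[ℝ] ℝ) (B : Finset (Fin n)) :
    w (wncInd B) = ∑ i ∈ B, w (Pi.single i 1) := by
  rw [wnc_lin]
  simp [wncInd]

/-- The only indicator vectors in the polytope are those of bases. -/
lemma wnc_vertex {ℬ : Finset (Fin n) → Prop} {B : Finset (Fin n)}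
    (h : wncInd B ∈ matroidPolytope ℬ) : ℬ B := by
  by_contra hB
  let g : (Fin n → ℝ) →ₗ[ℝ] ℝ := ∑ i, (if i ∈ B then (1 : ℝ) else -1) • LinearMap.proj i
  have hg : ∀ x, g x = ∑ i, (if i ∈ B then (1 : ℝ) else -1) * x i := by
    intro x; simp only [g, LinearMap.sum_apply, LinearMap.smul_apply, LinearMap.proj_apply,
      smul_eq_mul]
  have hsub : matroidPolytope ℬ ⊆ {x | g x < g (wncInd B)} := by
    apply convexHull_min
    · rintro _ ⟨B', hB', rfl⟩
      have hne : B' ≠ B := by rintro rfl; exact hB hB'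
      simp only [Set.mem_ofPred_eq, hg]
      apply Finset.sum_lt_sum
      · intro i _
        unfold wncInd
        by_cases h1 : i ∈ B <;> by_cases h2 : i ∈ B' <;> simp [h1, h2]
      · obtain ⟨i, hi⟩ : ∃ i, ¬ (i ∈ B' ↔ i ∈ B) := by
          by_contra hcon
          push Not at hcon
          exact hne (Finset.ext hcon)
        refine ⟨i, Finset.mem_univ i, ?_⟩
        unfold wncInd
        by_cases h1 : i ∈ B <;> by_cases h2 : i ∈ B' <;> simp [h1, h2] <;> tauto
    · exact convex_halfSpace_lt g.isLinear _
  exact lt_irrefl (g (wncInd B)) (Set.mem_ofPred.1 (hsub h))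

lemma wnc_polytope_inj {ℬ ℬ' : Finset (Fin n) → Prop}
    (h : matroidPolytope ℬ ⊆ matroidPolytope ℬ') {B : Finset (Fin n)} (hB : ℬ B) : ℬ' B :=
  wnc_vertex (h (wnc_ind_mem hB))

lemma wnc_polytope_nonempty {ℬ : Finset (Fin n) → Prop} (h : (matroidPolytope ℬ).Nonempty) :
    ∃ B, ℬ B := by
  unfold matroidPolytope at h
  rw [convexHull_nonempty_iff] at h
  obtain ⟨_, B, hB, -⟩ := h
  exact ⟨B, hB⟩

lemma wnc_face_polytope {ℬ : Finset (Fin n) → Prop} (hne : ∃ B, ℬ B)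
    (w : (Fin n → ℝ) →ₗ[ℝ] ℝ) :
    {x ∈ matroidPolytope ℬ | ∀ y ∈ matroidPolytope ℬ, w x ≤ w y}
      = matroidPolytope (wncMin ℬ (fun i => w (Pi.single i 1))) := by
  set c := fun i : Fin n => w (Pi.single i 1) with hc
  obtain ⟨B0, hB0⟩ := wncMin_exists hne c
  have hsub : matroidPolytope ℬ ⊆ {x | w (wncInd B0) ≤ w x ∧
      (w x = w (wncInd B0) → x ∈ matroidPolytope (wncMin ℬ c))} := by
    apply convexHull_min
    · rintro _ ⟨B, hB, rfl⟩
      change w (wncInd B0) ≤ w (wncInd B) ∧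
        (w (wncInd B) = w (wncInd B0) → wncInd B ∈ matroidPolytope (wncMin ℬ c))
      rw [wnc_lin_ind, wnc_lin_ind]
      refine ⟨hB0.2 B hB, fun h => wnc_ind_mem ⟨hB, fun B' hB' => ?_⟩⟩
      simp only [hc]
      rw [h]; exact hB0.2 B' hB'
    · rintro x ⟨hx1, hx2⟩ y ⟨hy1, hy2⟩ a b ha hb hab
      simp only [Set.mem_ofPred_eq, map_add, map_smul, smul_eq_mul]
      have hb' : b = 1 - a := by linarith
      refine ⟨by subst hb'; nlinarith, fun h => ?_⟩
      rcases ha.eq_or_lt with h0 | hapos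
      · have : b = 1 := by linarith
        subst this
        rw [← h0] at h ⊢
        simp only [zero_mul, one_mul, zero_add] at h
        simpa using hy2 h
      rcases hb.eq_or_lt with h0 | hbpos
      · have : a = 1 := by linarith
        subst this
        rw [← h0] at h ⊢
        simp only [zero_mul, one_mul, add_zero] at h
        simpa using hx2 h
      have e1 : a * (w x - w (wncInd B0)) + b * (w y - w (wncInd B0)) = 0 := by
        have : a * w (wncInd B0) + b * w (wncInd B0) = w (wncInd B0) := by
          rw [← add_mul, hab, one_mul]
        linarith
      have p1 := mul_nonneg ha (sub_nonneg.2 hx1)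
      have p2 := mul_nonneg hb (sub_nonneg.2 hy1)
      have z1 : a * (w x - w (wncInd B0)) = 0 := by linarith
      have z2 : b * (w y - w (wncInd B0)) = 0 := by linarith
      have z1' := (mul_eq_zero.1 z1).resolve_left hapos.ne'
      have z2' := (mul_eq_zero.1 z2).resolve_left hbpos.ne'
      exact convex_convexHull ℝ _ (hx2 (by linarith)) (hy2 (by linarith)) ha hb hab
  apply Set.Subset.antisymm
  · rintro x ⟨hx, hmin⟩
    exact (hsub hx).2 (le_antisymm (hmin _ (wnc_ind_mem hB0.1)) (hsub hx).1)
  · intro x hx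
    have h1 : x ∈ matroidPolytope ℬ := by
      refine convexHull_mono ?_ hx
      rintro _ ⟨B, hB, rfl⟩
      exact ⟨B, hB.1, rfl⟩
    have h2 : matroidPolytope (wncMin ℬ c) ⊆ {x | w x ≤ w (wncInd B0)} := by
      apply convexHull_min
      · rintro _ ⟨B, hB, rfl⟩
        change w (wncInd B) ≤ w (wncInd B0)
        rw [wnc_lin_ind, wnc_lin_ind]
        exact hB.2 _ hB0.1
      · exact convex_halfSpace_le w.isLinear _
    exact ⟨h1, fun y hy => le_trans (h2 hx) (hsub hy).1⟩

lemma wnc_face_form {K F : Set (Fin n → ℝ)} (hF : IsFace K F) (hne : F.Nonempty) :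
    ∃ w : (Fin n → ℝ) →ₗ[ℝ] ℝ, F = {x ∈ K | ∀ y ∈ K, w x ≤ w y} := by
  rcases hF with h | h | h
  · exact absurd h hne.ne_empty
  · refine ⟨0, ?_⟩
    rw [h]; ext x; simp
  · exact h

lemma wnc_partition_sum {M : Type*} [AddCommMonoid M] {P : Finset (Finset (Fin n) × ℕ)}
    (hP : ∀ x : Fin n, ∃! p, p ∈ P ∧ x ∈ p.1) (g : Fin n → M) :
    ∑ i, g i = ∑ p ∈ P, ∑ i ∈ p.1, g i := by
  classical
  rw [← Finset.sum_biUnion]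
  · refine Finset.sum_congr ?_ fun _ _ => rfl
    ext x
    obtain ⟨p, hp, -⟩ := hP x
    simp only [Finset.mem_univ, Finset.mem_biUnion, true_iff]
    exact ⟨p, hp⟩
  · intro p hp q hq hpq
    rw [Function.onFun, Finset.disjoint_left]
    intro x hx hx'
    exact hpq (wnc_block_unique hP hp hq hx hx')

/-- The linear equations attached to a weighted partition. -/
def wncSat (P : Finset (Finset (Fin n) × ℕ)) (x : Fin n → ℝ) : Prop :=
  ∀ p ∈ P, ∑ i ∈ p.1, x i = (p.2 : ℝ)

lemma wnc_sat_of_mem {N : Finset (Fin n) → Prop} {P : Finset (Finset (Fin n) × ℕ)}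
    (hP : IsWeightedCompPartition N P) {x : Fin n → ℝ} (hx : x ∈ matroidPolytope N) :
    wncSat P x := by
  intro p hp
  have : matroidPolytope N ⊆ {x | ∑ i ∈ p.1, x i = (p.2 : ℝ)} := by
    apply convexHull_min
    · rintro _ ⟨B, hB, rfl⟩
      change ∑ i ∈ p.1, wncInd B i = _
      rw [wnc_ind_sum, hP.2.2.2.2 p hp B hB]
    · intro x hx y hy a b _ _ hab
      simp only [Set.mem_ofPred_eq] at hx hy
      simp only [Set.mem_ofPred_eq, Pi.add_apply, Pi.smul_apply, smul_eq_mul,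
        Finset.sum_add_distrib, ← Finset.mul_sum, hx, hy]
      rw [← add_mul, hab, one_mul]
  exact this hx

lemma wnc_mem_face {ℬ N : Finset (Fin n) → Prop} {F : Set (Fin n → ℝ)}
    (hF : IsFace (matroidPolytope ℬ) F) (hne : F.Nonempty) (hN : F = matroidPolytope N)
    (hB : IsBasesSet N) {P : Finset (Finset (Fin n) × ℕ)} (hP : IsWeightedCompPartition N P)
    {x : Fin n → ℝ} (hx : x ∈ matroidPolytope ℬ) (hs : wncSat P x) : x ∈ F := by
  obtain ⟨w, hw⟩ := wnc_face_form hF hne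
  obtain ⟨B, hBN⟩ := hB.1
  have hmem : ∀ B, N B → wncInd B ∈ F := fun B h => by rw [hN]; exact wnc_ind_mem h
  have hmin : ∀ B, N B → wncInd B ∈ matroidPolytope ℬ ∧
      ∀ y ∈ matroidPolytope ℬ, w (wncInd B) ≤ w y := fun B h => by
    have := hmem B h
    rw [hw] at this
    exact this
  have hconst : ∀ B', N B' → ∑ i ∈ B', w (Pi.single i 1) = w (wncInd B) := by
    intro B' hB'
    rw [← wnc_lin_ind]
    exact le_antisymm ((hmin B' hB').2 _ (hmin B hBN).1) ((hmin B hBN).2 _ (hmin B' hB').1)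
  have hwx : w x = w (wncInd B) := by
    rw [wnc_lin w x, wnc_lin w (wncInd B), wnc_partition_sum hP.1, wnc_partition_sum hP.1]
    refine Finset.sum_congr rfl fun p hp => ?_
    obtain ⟨z, hz⟩ := hP.2.1 p hp
    have e : ∀ u : Fin n → ℝ, ∑ i ∈ p.1, u i * w (Pi.single i 1)
        = (∑ i ∈ p.1, u i) * w (Pi.single z 1) := by
      intro u
      rw [Finset.sum_mul]
      refine Finset.sum_congr rfl fun i hi => ?_
      rw [wnc_const hB hP hp (fun i => w (Pi.single i 1)) _ hconst hi hz]
    rw [e, e, hs p hp, wnc_sat_of_mem hP (wnc_ind_mem hBN) p hp]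
  rw [hw]
  exact ⟨hx, fun y hy => by rw [hwx]; exact (hmin B hBN).2 y hy⟩

end Faces

section Chains

variable {n : ℕ}

lemma wnc_cross_symm {S T : Finset (Fin n)} (h : wncCross S T) : wncCross T S := by
  obtain ⟨s, hs, s', hs', t, ht, t', ht', h1, h2, h3 | h3⟩ := h
  · exact ⟨t, ht, t', ht', s', hs', s, hs, h3, h1, Or.inr h2⟩
  · exact ⟨t', ht', t, ht, s, hs, s', hs', h2, h3, Or.inl h1⟩

lemma wnc_cross_mono {S S' T T' : Finset (Fin n)} (h : wncCross S T) (hS : S ⊆ S') (hT : T ⊆ T') :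
    wncCross S' T' := by
  obtain ⟨s, hs, s', hs', t, ht, t', ht', h1⟩ := h
  exact ⟨s, hS hs, s', hS hs', t, hT ht, t', hT ht', h1⟩

lemma wnc_fin_sub (a b : Fin n) :
    (b - a).val = if a.val ≤ b.val then b.val - a.val else n + b.val - a.val := by
  have ha := a.2
  have hb := b.2
  rw [Fin.sub_def]
  simp only
  split_ifs with h
  · have : n - a.val + b.val = n + (b.val - a.val) := by omega
    rw [this, Nat.add_mod_left, Nat.mod_eq_of_lt (by omega)]
  · rw [Nat.mod_eq_of_lt (by omega)]; omega

lemma wnc_cyc_cross {S T : Finset (Fin n)} {a b c d : Fin n} (ha : a ∈ S) (hc : c ∈ S)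
    (hb : b ∈ T) (hd : d ∈ T) (h : Cyc4 a b c d) : wncCross S T := by
  unfold Cyc4 at h
  rw [wnc_fin_sub, wnc_fin_sub, wnc_fin_sub] at h
  have h1 := a.2
  have h2 := b.2
  have h3 := c.2
  have h4 := d.2
  have key : (b.val < c.val ∧ c.val < d.val ∧ (a.val < b.val ∨ d.val < a.val)) ∨
      (d.val < a.val ∧ a.val < b.val ∧ (c.val < d.val ∨ b.val < c.val)) := by
    split_ifs at h <;> omega
  rcases key with ⟨k1, k2, k3⟩ | ⟨k1, k2, k3⟩
  · exact ⟨c, hc, a, ha, b, hb, d, hd, k1, k2, k3⟩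
  · exact ⟨a, ha, c, hc, d, hd, b, hb, k1, k2, k3⟩

/-- A non-crossing partition whose weights are read off from the set `B`. -/
structure WncGood (B : Finset (Fin n)) (P : Finset (Finset (Fin n) × ℕ)) : Prop where
  part : ∀ x : Fin n, ∃! p, p ∈ P ∧ x ∈ p.1
  ne : ∀ p ∈ P, (Prod.fst p).Nonempty
  nc : ∀ p ∈ P, ∀ q ∈ P, p ≠ q → ¬ wncCross p.1 q.1
  wt : ∀ p ∈ P, (B ∩ (Prod.fst p)).card = Prod.snd p

lemma WncGood.isWNCP {B : Finset (Fin n)} {P : Finset (Finset (Fin n) × ℕ)} (h : WncGood B P) :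
    IsWNCP n B.card P := by
  refine ⟨fun p hp => ⟨h.ne p hp, ?_⟩, h.part, ?_, ?_⟩
  · rw [← h.wt p hp]; exact Finset.card_le_card Finset.inter_subset_right
  · rintro ⟨p, hp, q, hq, hpq, a, b, c, d, ha, hc, hb, hd, hcyc⟩
    exact h.nc p hp q hq (fun e => hpq (by rw [e])) (wnc_cyc_cross ha hc hb hd hcyc)
  · have := wnc_partition_sum h.part (fun i => if i ∈ B then 1 else 0)
    simp only [Finset.sum_ite_mem, Finset.univ_inter, Finset.sum_const, smul_eq_mul, mul_one] at this
    rw [this]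
    refine Finset.sum_congr rfl fun p hp => ?_
    rw [← h.wt p hp, Finset.inter_comm]

lemma wnc_merge {B : Finset (Fin n)} {P Q : Finset (Finset (Fin n) × ℕ)} (hP : WncGood B P)
    (hQ : WncGood B Q) (href : ∀ p ∈ P, ∃ q ∈ Q, p.1 ⊆ q.1)
    {q : Finset (Fin n) × ℕ} (hq : q ∈ Q) {a b : Fin n} (ha : a ∈ q.1) (hb : b ∈ q.1)
    (hab : a < b) (hcons : ∀ z ∈ q.1, a < z → z < b → False)
    {pa pb : Finset (Fin n) × ℕ} (hpa : pa ∈ P) (hpb : pb ∈ P) (haa : a ∈ pa.1) (hbb : b ∈ pb.1)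
    (hne : pa ≠ pb) :
    ∃ P', WncGood B P' ∧ (∀ p ∈ P', ∃ q ∈ Q, p.1 ⊆ q.1) ∧ P'.card < P.card ∧ WNCPCover P P' := by
  have uniq := fun {p q : Finset (Fin n) × ℕ} (hp : p ∈ P) (hq : q ∈ P) {x : Fin n}
    (h : x ∈ p.1) (h' : x ∈ q.1) => wnc_block_unique hP.part hp hq h h'
  have uniqQ := fun {p q : Finset (Fin n) × ℕ} (hp : p ∈ Q) (hq : q ∈ Q) {x : Fin n}
    (h : x ∈ p.1) (h' : x ∈ q.1) => wnc_block_unique hQ.part hp hq h h'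
  have hsub : ∀ p ∈ P, ∀ x ∈ p.1, x ∈ q.1 → p.1 ⊆ q.1 := by
    intro p hp x hx hxq
    obtain ⟨q', hq', hpq'⟩ := href p hp
    have := uniqQ hq' hq (hpq' hx) hxq
    rw [← this]; exact hpq'
  have hsa := hsub pa hpa a haa ha
  have hsb := hsub pb hpb b hbb hb
  have hdis : Disjoint pa.1 pb.1 := by
    rw [Finset.disjoint_left]
    intro x hx hx'
    exact hne (uniq hpa hpb hx hx')
  have hab1 : pa.1 ≠ pb.1 := by
    intro h
    exact hne (uniq hpa hpb haa (h ▸ haa))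
  -- old blocks do not cross the merged block
  have hnc : ∀ r ∈ P, r ≠ pa → r ≠ pb → ¬ wncCross (pa.1 ∪ pb.1) r.1 := by
    intro r hr hra hrb hcr
    have na : ∀ x ∈ pa.1, ∀ y ∈ r.1, x ≠ y := by
      rintro x hx y hy rfl; exact hra (uniq hr hpa hy hx)
    have nb : ∀ x ∈ pb.1, ∀ y ∈ r.1, x ≠ y := by
      rintro x hx y hy rfl; exact hrb (uniq hr hpb hy hx)
    by_cases hrq : r.1 ⊆ q.1
    · obtain ⟨s, hs, s', hs', t, ht, t', ht', h1, h2, h3⟩ := hcr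
      -- sides of the chord
      have side : ∀ p ∈ P, p ≠ r → ∀ x ∈ p.1, ∀ y ∈ p.1, t < x → x < t' → t < y ∧ y < t' := by
        intro p hp hpr x hx y hy hx1 hx2
        have e1 : y ≠ t := by rintro rfl; exact hpr (uniq hp hr hy ht)
        have e2 : y ≠ t' := by rintro rfl; exact hpr (uniq hp hr hy ht')
        by_contra hcon
        apply hP.nc p hp r hr hpr
        refine ⟨x, hx, y, hy, t, ht, t', ht', hx1, hx2, ?_⟩
        rcases lt_or_gt_of_ne e1 with h | h
        · exact Or.inl h
        · rcases lt_or_gt_of_ne e2 with h' | h'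
          · exact absurd ⟨h, h'⟩ hcon
          · exact Or.inr h'
      have hout : ¬ (t < s' ∧ s' < t') := by
        rintro ⟨u, v⟩
        rcases h3 with h | h
        · exact absurd u h.not_gt
        · exact absurd v h.not_gt
      have hta := na a haa t ht
      have hta' := na a haa t' ht'
      have htb := nb b hbb t ht
      have htb' := nb b hbb t' ht'
      have hct := hcons t (hrq ht)
      have hct' := hcons t' (hrq ht')
      rw [Finset.mem_union] at hs hs'
      rcases hs with hs | hs <;> rcases hs' with hs' | hs'
      · exact hout (side pa hpa hra.symm s hs s' hs' h1 h2)
      · have i1 := side pa hpa hra.symm s hs a haa h1 h2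
        have i2 : ¬ (t < b ∧ b < t') := fun h =>
          hout (side pb hpb hrb.symm b hbb s' hs' h.1 h.2)
        by_cases hbt : b < t'
        · exact i2 ⟨i1.1.trans hab, hbt⟩
        · exact hct' i1.2 (lt_of_le_of_ne (not_lt.1 hbt) htb'.symm)
      · have i1 := side pb hpb hrb.symm s hs b hbb h1 h2
        have i2 : ¬ (t < a ∧ a < t') := fun h =>
          hout (side pa hpa hra.symm a haa s' hs' h.1 h.2)
        by_cases hat : t < a
        · exact i2 ⟨hat, hab.trans i1.2⟩
        · exact hct (lt_of_le_of_ne (not_lt.1 hat) hta) i1.1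
      · exact hout (side pb hpb hrb.symm s hs s' hs' h1 h2)
    · obtain ⟨q', hq', hrq'⟩ := href r hr
      have hqq : q ≠ q' := by rintro rfl; exact hrq hrq'
      exact hQ.nc q hq q' hq' hqq (wnc_cross_mono hcr (Finset.union_subset hsa hsb) hrq')
  set m : Finset (Fin n) × ℕ := (pa.1 ∪ pb.1, pa.2 + pb.2) with hm
  have hmem : ∀ r, r ∈ insert m ((P.erase pa).erase pb) ↔ r = m ∨ (r ∈ P ∧ r ≠ pa ∧ r ≠ pb) := by
    intro r; simp only [Finset.mem_insert, Finset.mem_erase]; tauto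
  refine ⟨insert m ((P.erase pa).erase pb), ⟨?_, ?_, ?_, ?_⟩, ?_, ?_, ?_⟩
  · intro x
    obtain ⟨p, ⟨hp, hxp⟩, -⟩ := hP.part x
    by_cases hx : x ∈ m.1
    · refine ⟨m, ⟨by simp, hx⟩, ?_⟩
      rintro r ⟨hr, hxr⟩
      rcases (hmem r).1 hr with h | ⟨h, h1, h2⟩
      · exact h
      · rw [hm, Finset.mem_union] at hx
        rcases hx with hx | hx
        · exact absurd (uniq h hpa hxr hx) h1
        · exact absurd (uniq h hpb hxr hx) h2
    · have h1 : p ≠ pa := by rintro rfl; exact hx (by simp [hm, hxp])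
      have h2 : p ≠ pb := by rintro rfl; exact hx (by simp [hm, hxp])
      refine ⟨p, ⟨(hmem p).2 (Or.inr ⟨hp, h1, h2⟩), hxp⟩, ?_⟩
      rintro r ⟨hr, hxr⟩
      rcases (hmem r).1 hr with h | ⟨h, h1, h2⟩
      · rw [h] at hxr; exact absurd hxr hx
      · exact uniq h hp hxr hxp
  · intro r hr
    rcases (hmem r).1 hr with h | ⟨h, h1, h2⟩
    · rw [h]; exact ⟨a, by simp [hm, haa]⟩
    · exact hP.ne r h
  · intro r hr s hs hrs
    rcases (hmem r).1 hr with h | ⟨h, h1, h2⟩ <;> rcases (hmem s).1 hs with h' | ⟨h', h1', h2'⟩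
    · exact absurd (h.trans h'.symm) hrs
    · rw [h]; exact hnc s h' h1' h2'
    · rw [h']; exact fun hc => hnc r h h1 h2 (wnc_cross_symm hc)
    · exact hP.nc r h s h' hrs
  · intro r hr
    rcases (hmem r).1 hr with h | ⟨h, h1, h2⟩
    · rw [h]
      simp only [hm]
      rw [Finset.inter_union_distrib_left, Finset.card_union_of_disjoint, hP.wt pa hpa,
        hP.wt pb hpb]
      exact hdis.mono Finset.inter_subset_right Finset.inter_subset_right
    · exact hP.wt r h
  · intro r hr
    rcases (hmem r).1 hr with h | ⟨h, h1, h2⟩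
    · exact ⟨q, hq, by rw [h]; exact Finset.union_subset hsa hsb⟩
    · exact href r h
  · have c1 := Finset.card_insert_le m ((P.erase pa).erase pb)
    have hpb' : pb ∈ P.erase pa := Finset.mem_erase.2 ⟨hne.symm, hpb⟩
    rw [Finset.card_erase_of_mem hpb', Finset.card_erase_of_mem hpa] at c1
    have c2 := Finset.card_pos.2 ⟨pb, hpb'⟩
    rw [Finset.card_erase_of_mem hpa] at c2
    omega
  · exact ⟨pa.1, pb.1, pa.2, pb.2, hpa, hpb, hab1, rfl⟩

lemma wnc_chain {B : Finset (Fin n)} {Q : Finset (Finset (Fin n) × ℕ)} (hQ : WncGood B Q) :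
    ∀ (k : ℕ) (P : Finset (Finset (Fin n) × ℕ)), P.card = k → WncGood B P →
      (∀ p ∈ P, ∃ q ∈ Q, p.1 ⊆ q.1) →
      Relation.ReflTransGen (fun X Y => IsWNCP n B.card X ∧ IsWNCP n B.card Y ∧ WNCPCover X Y)
        P Q := by
  intro k
  induction k using Nat.strong_induction_on with
  | _ k ih =>
  intro P hk hP href
  by_cases hex : ∃ m : ℕ, ∃ q ∈ Q, ∃ a ∈ q.1, ∃ b ∈ q.1, a < b ∧ b.val - a.val = m ∧
      ∃ pa ∈ P, ∃ pb ∈ P, a ∈ pa.1 ∧ b ∈ pb.1 ∧ pa ≠ pb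
  · classical
    obtain ⟨q, hq, a, ha, b, hb, hab, hm, pa, hpa, pb, hpb, haa, hbb, hne⟩ := Nat.find_spec hex
    have hmin := fun j hj => Nat.find_min (H := hex) (m := j) hj
    have hcons : ∀ z ∈ q.1, a < z → z < b → False := by
      intro z hz h1 h2
      have h1' : a.val < z.val := h1
      have h2' : z.val < b.val := h2
      obtain ⟨pz, ⟨hpz, hzz⟩, -⟩ := hP.part z
      by_cases hza : pz = pa
      · exact hmin (b.val - z.val) (by omega) ⟨q, hq, z, hz, b, hb, h2, rfl, pz, hpz, pb, hpb,
          hzz, hbb, by rw [hza]; exact hne⟩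
      · exact hmin (z.val - a.val) (by omega) ⟨q, hq, a, ha, z, hz, h1, rfl, pa, hpa, pz, hpz,
          haa, hzz, fun h => hza h.symm⟩
    obtain ⟨P', hP', href', hcard, hcov⟩ :=
      wnc_merge hP hQ href hq ha hb hab hcons hpa hpb haa hbb hne
    exact Relation.ReflTransGen.head ⟨hP.isWNCP, hP'.isWNCP, hcov⟩
      (ih P'.card (hk ▸ hcard) P' rfl hP' href')
  · have same : ∀ q ∈ Q, ∀ a ∈ q.1, ∀ b ∈ q.1, ∀ pa ∈ P, ∀ pb ∈ P, a ∈ pa.1 → b ∈ pb.1 →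
        pa = pb := by
      intro q hq a ha b hb pa hpa pb hpb haa hbb
      by_contra hne
      rcases lt_trichotomy a b with h | h | h
      · exact hex ⟨_, q, hq, a, ha, b, hb, h, rfl, pa, hpa, pb, hpb, haa, hbb, hne⟩
      · subst h; exact hne (wnc_block_unique hP.part hpa hpb haa hbb)
      · exact hex ⟨_, q, hq, b, hb, a, ha, h, rfl, pb, hpb, pa, hpa, hbb, haa, fun h => hne h.symm⟩
    have eqv : ∀ p ∈ P, ∀ q ∈ Q, ∀ x, x ∈ p.1 → x ∈ q.1 → p = q := by
      intro p hp q hq x hxp hxq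
      have h1 : p.1 = q.1 := by
        apply Finset.Subset.antisymm
        · obtain ⟨q', hq', hs⟩ := href p hp
          have := wnc_block_unique hQ.part hq' hq (hs hxp) hxq
          rw [← this]; exact hs
        · intro y hy
          obtain ⟨py, ⟨hpy, hyy⟩, -⟩ := hP.part y
          rw [same q hq x hxq y hy p hp py hpy hxp hyy]; exact hyy
      have h2 : p.2 = q.2 := by rw [← hP.wt p hp, ← hQ.wt q hq, h1]
      exact Prod.ext h1 h2
    have : P = Q := by
      ext r
      constructor
      · intro hr
        obtain ⟨x, hx⟩ := hP.ne r hr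
        obtain ⟨q, ⟨hq, hxq⟩, -⟩ := hQ.part x
        rw [eqv r hr q hq x hx hxq]; exact hq
      · intro hr
        obtain ⟨x, hx⟩ := hQ.ne r hr
        obtain ⟨p, ⟨hp, hxp⟩, -⟩ := hP.part x
        rw [← eqv p hp r hr x hxp hx]; exact hp
    rw [this]

lemma wnc_sat_cover {d : ℕ} {X Y : Finset (Finset (Fin n) × ℕ)} (hX : IsWNCP n d X)
    (h : WNCPCover X Y) {x : Fin n → ℝ} (hs : wncSat X x) : wncSat Y x := by
  obtain ⟨A, B, a, b, hA, hB, hne, rfl⟩ := h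
  intro p hp
  simp only [Finset.mem_insert, Finset.mem_erase] at hp
  rcases hp with rfl | hp
  · have hdis : Disjoint A B := by
      rw [Finset.disjoint_left]
      intro z hz hz'
      exact hne (congrArg Prod.fst (wnc_block_unique hX.2.1 hA hB hz hz'))
    simp only
    rw [Finset.sum_union hdis, hs _ hA, hs _ hB]
    push_cast; rfl
  · exact hs p hp.2.2

lemma wnc_sat_le {d : ℕ} {P Q : Finset (Finset (Fin n) × ℕ)} (h : WNCPle n d P Q)
    {x : Fin n → ℝ} (hs : wncSat P x) : wncSat Q x := by
  obtain ⟨-, -, h⟩ := h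
  induction h with
  | refl => exact hs
  | tail _ h ih => exact wnc_sat_cover h.1 h.2.2 ih

end Chains

/-- Let `M` be a rank-`d` positroid on `[n]`.  Every nonempty
face `F` of `Γ_M` equals `Γ_N` for a unique positroid `N = N(F)` on `[n]`
(identified with its finite collection of bases), and the map sending each
nonempty face `F` to the weighted non-crossing partition `Π^w_{N(F)}` — whose
blocks are the ground sets of the connected components of `N(F)`, each weighted
by its rank in `N(F)` — and sending the empty face to `0̂`, embeds the face
poset of `Γ_M` as an induced subposet of `NC_n^d ∪ {0̂}`: every nonempty face is
sent to an element of `NC_n^d`, the map is injective, and `F ⊆ G` if and only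
if the image of `F` is `≤` the image of `G` in `NC_n^d ∪ {0̂}`. -/
theorem face_poset_embeds_in_weighted_noncrossing (n d : ℕ)
    (ℬ : Finset (Fin n) → Prop) (hpos : IsPositroidOfRank d ℬ) :
    (∀ F : Set (Fin n → ℝ), IsFace (matroidPolytope ℬ) F → F.Nonempty →
      ∃! N : Finset (Finset (Fin n)),
        IsPositroid (fun B => B ∈ N) ∧ F = matroidPolytope (fun B => B ∈ N)) ∧
    ∀ Φ : Set (Fin n → ℝ) → Option (Finset (Finset (Fin n) × ℕ)),
      (∀ F, IsFace (matroidPolytope ℬ) F →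
        (F = ∅ → Φ F = none) ∧
        (F.Nonempty → ∃ (N : Finset (Finset (Fin n))) (P : Finset (Finset (Fin n) × ℕ)),
          IsPositroid (fun B => B ∈ N) ∧ F = matroidPolytope (fun B => B ∈ N) ∧
          IsWeightedCompPartition (fun B => B ∈ N) P ∧ Φ F = some P)) →
      (∀ F, IsFace (matroidPolytope ℬ) F → F.Nonempty →
        ∃ P, Φ F = some P ∧ IsWNCP n d P) ∧
      (∀ F G, IsFace (matroidPolytope ℬ) F → IsFace (matroidPolytope ℬ) G →
        Φ F = Φ G → F = G) ∧
      (∀ F G, IsFace (matroidPolytope ℬ) F → IsFace (matroidPolytope ℬ) G →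
        (F ⊆ G ↔ WNCPleBot n d (Φ F) (Φ G))) := by
  classical
  have faceN : ∀ F : Set (Fin n → ℝ), IsFace (matroidPolytope ℬ) F → F.Nonempty →
      (∃ B, ℬ B) ∧ ∃ w : Fin n → ℝ, F = matroidPolytope (wncMin ℬ w) := by
    intro F hF hne
    obtain ⟨w, hw⟩ := wnc_face_form hF hne
    have hb : ∃ B, ℬ B := by
      obtain ⟨x, hx⟩ := hne
      rw [hw] at hx
      exact wnc_polytope_nonempty ⟨x, hx.1⟩
    exact ⟨hb, _, hw.trans (wnc_face_polytope hb w)⟩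
  refine ⟨?_, ?_⟩
  · intro F hF hne
    obtain ⟨hb, w, hw⟩ := faceN F hF hne
    have hN : (fun B => B ∈ univ.filter (wncMin ℬ w)) = wncMin ℬ w := by
      ext B; simp
    refine ⟨univ.filter (wncMin ℬ w), ⟨⟨d, ?_⟩, ?_⟩, ?_⟩
    · rw [hN]; exact wncMin_positroid hpos hb w
    · rw [hN]; exact hw
    · rintro N' ⟨-, h2⟩
      ext B
      constructor
      · intro h
        have := wnc_polytope_inj (ℬ := fun B => B ∈ N') (ℬ' := wncMin ℬ w)
          (by rw [← h2, ← hw]) h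
        simpa using this
      · intro h
        have h' : wncMin ℬ w B := by simpa using h
        exact wnc_polytope_inj (ℬ := wncMin ℬ w) (ℬ' := fun B => B ∈ N')
          (by rw [← h2, ← hw]) h'
  intro Φ hΦ
  obtain ⟨A, hA, hR⟩ := id hpos
  -- the data attached to a nonempty face
  have data : ∀ F : Set (Fin n → ℝ), IsFace (matroidPolytope ℬ) F → F.Nonempty →
      ∃ (N : Finset (Finset (Fin n))) (P : Finset (Finset (Fin n) × ℕ)),
        F = matroidPolytope (fun B => B ∈ N) ∧ Φ F = some P ∧ IsBasesSet (fun B => B ∈ N) ∧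
        IsWeightedCompPartition (fun B => B ∈ N) P ∧
        (∀ B ∈ N, B.card = d) ∧ ∀ B ∈ N, WncGood B P := by
    intro F hF hne
    obtain ⟨N, P, ⟨d', A', hA', hR'⟩, hFN, hP, hΦF⟩ := (hΦ F hF).2 hne
    obtain ⟨hb, w, hw⟩ := faceN F hF hne
    have hNne : ∃ B, B ∈ N := by
      rw [hFN] at hne
      exact wnc_polytope_nonempty hne
    refine ⟨N, P, hFN, hΦF, wnc_isBases hR' hNne, hP, ?_, ?_⟩
    · intro B hB
      have := wnc_polytope_inj (ℬ := fun B => B ∈ N) (ℬ' := wncMin ℬ w)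
        (by rw [← hFN, ← hw]) hB
      exact ((hR B).1 this.1).1
    · intro B hB
      exact ⟨hP.1, hP.2.1, fun p hp q hq hpq =>
        wnc_positroid_noncross hA' hR' hNne hP hp hq hpq, fun p hp => hP.2.2.2.2 p hp B hB⟩
  have wncp : ∀ F, IsFace (matroidPolytope ℬ) F → F.Nonempty →
      ∃ P, Φ F = some P ∧ IsWNCP n d P := by
    intro F hF hne
    obtain ⟨N, P, hFN, hΦF, hBs, hP, hcard, hgood⟩ := data F hF hne
    obtain ⟨B, hB⟩ := hBs.1
    exact ⟨P, hΦF, hcard B hB ▸ (hgood B hB).isWNCP⟩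
  have order : ∀ F G, IsFace (matroidPolytope ℬ) F → IsFace (matroidPolytope ℬ) G →
        (F ⊆ G ↔ WNCPleBot n d (Φ F) (Φ G)) := by
    intro F G hF hG
    rcases F.eq_empty_or_nonempty with hFe | hFne
    · have := (hΦ F hF).1 hFe
      constructor
      · intro _; exact Or.inl this
      · intro _; rw [hFe]; exact Set.empty_subset _
    obtain ⟨N, P, hFN, hΦF, hBs, hP, hcard, hgood⟩ := data F hF hFne
    obtain ⟨B, hB⟩ := hBs.1
    constructor
    · intro hsub
      obtain ⟨N', Q, hGN, hΦG, hBs', hQ, hcard', hgood'⟩ := data G hG (hFne.mono hsub)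
      have hNN : ∀ C, C ∈ N → C ∈ N' := fun C hC =>
        wnc_polytope_inj (ℬ := fun B => B ∈ N) (ℬ' := fun B => B ∈ N')
          (by rw [← hFN, ← hGN]; exact hsub) hC
      have gP := hgood B hB
      have gQ := hgood' B (hNN B hB)
      have hBd := hcard B hB
      refine Or.inr ⟨P, Q, hΦF, hΦG, hBd ▸ gP.isWNCP, hBd ▸ gQ.isWNCP, ?_⟩
      have href : ∀ p ∈ P, ∃ q ∈ Q, p.1 ⊆ q.1 := by
        intro p hp
        obtain ⟨x, hx⟩ := hP.2.1 p hp
        obtain ⟨q, ⟨hq, hxq⟩, -⟩ := hQ.1 x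
        refine ⟨q, hq, fun y hy => ?_⟩
        have := wnc_const hBs hP hp (wncInd q.1) (q.2 : ℝ) (fun C hC => by
          rw [wnc_ind_sum, Finset.inter_comm, hQ.2.2.2.2 q hq C (hNN C hC)]) hx hy
        by_contra hyq
        simp [wncInd, hxq, hyq] at this
      have := wnc_chain gQ _ P rfl gP href
      rw [hBd] at this
      exact this
    · rintro (h | ⟨P', Q, hP', hQ', hle⟩)
      · rw [hΦF] at h; exact absurd h (by simp)
      · have hGne : G.Nonempty := by
          rw [Set.nonempty_iff_ne_empty]
          intro h
          rw [(hΦ G hG).1 h] at hQ'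
          exact absurd hQ' (by simp)
        obtain ⟨N', Q', hGN, hΦG, hBs', hQ, hcard', hgood'⟩ := data G hG hGne
        rw [hΦG, Option.some.injEq] at hQ'
        rw [hΦF, Option.some.injEq] at hP'
        subst hQ' hP'
        intro x hx
        have hxK : x ∈ matroidPolytope ℬ := by
          obtain ⟨w, hw⟩ := wnc_face_form hF hFne
          rw [hw] at hx
          exact hx.1
        refine wnc_mem_face hG hGne hGN hBs' hQ hxK (wnc_sat_le hle ?_)
        rw [hFN] at hx
        exact wnc_sat_of_mem hP hx
  refine ⟨wncp, ?_, order⟩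
  intro F G hF hG hFG
  have refl : ∀ H, IsFace (matroidPolytope ℬ) H → WNCPleBot n d (Φ H) (Φ H) := by
    intro H hH
    exact (order H H hH hH).1 (le_refl _)
  apply Set.Subset.antisymm
  · rw [order F G hF hG, ← hFG]; exact refl F hF
  · rw [order G F hG hF, ← hFG]; exact refl F hF
end
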